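/- Let 0 < θ ≤ 0.0539·π and let q be an action minimizer of A over P(Q_S, Q_{E₁}). Then q extends to a global orbit: there exists a twice continuously differentiable function Q:ℝ→(ℝ²)⁴ that is collision-free for all t∈ℝ, solves the Newtonian equations on all of ℝ, satisfies Q(t)=q(t) for every t∈[0,1], and satisfies the rotation symmetry Qᵢ(t+8) = Qᵢ(t)·R(8θ) (row-vector multiplication, for each body i) for all t∈ℝ. In particular, if θ = (k/l)·π for positive integers k, l, then Q is periodic with period 8l. -/

import Mathlib

open Real MeasureTheory Set
open scoped ENNReal

noncomputable section

/-- Euclidean norm on `ℝ × ℝ` (row vectors in the plane). -/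
def enorm2 (v : ℝ × ℝ) : ℝ := Real.sqrt (v.1 ^ 2 + v.2 ^ 2)

/-- Row vector multiplied on the right by the rotation matrix `R θ`
with rows `(cos θ, sin θ)` and `(-sin θ, cos θ)`. -/
def rotV (θ : ℝ) (v : ℝ × ℝ) : ℝ × ℝ :=
  (v.1 * Real.cos θ - v.2 * Real.sin θ, v.1 * Real.sin θ + v.2 * Real.cos θ)

/-- `H¹([0,1],(ℝ²)⁴)`: absolutely continuous paths `[0,1] → (ℝ²)⁴` with
square-integrable derivative, recorded via an integrable (a.e.-)derivative `v`
together with the integral representation of `q`. -/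
structure H1Path4 where
  q : ℝ → Fin 4 → ℝ × ℝ
  v : ℝ → Fin 4 → ℝ × ℝ
  hvInt : ∀ i : Fin 4, IntegrableOn (fun t => v t i) (Icc (0:ℝ) 1)
  hrep : ∀ i : Fin 4, ∀ t ∈ Icc (0:ℝ) 1, q t i = q 0 i + ∫ s in (0:ℝ)..t, v s i
  hL2 : ∀ i : Fin 4, IntegrableOn (fun t => enorm2 (v t i) ^ 2) (Icc (0:ℝ) 1)

/-- Center of mass at the origin throughout `[0,1]` (the path lies in `χ`). -/
def H1Path4.inChi (p : H1Path4) : Prop := ∀ t ∈ Icc (0:ℝ) 1, ∑ i, p.q t i = 0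

/-- The Lagrangian action functional `A`, with value `+∞` allowed. -/
def action (p : H1Path4) : ℝ≥0∞ :=
  ∫⁻ t in Icc (0:ℝ) 1,
    (ENNReal.ofReal ((1/2) * ∑ i, enorm2 (p.v t i) ^ 2)
      + ∑ i : Fin 4, ∑ j ∈ Finset.univ.filter (fun j => i < j),
          (ENNReal.ofReal (enorm2 (p.q t i - p.q t j)))⁻¹)

/-- The starting boundary configuration set `Q_S` (double isosceles with order
constraints). -/
def QSset : Set (Fin 4 → ℝ × ℝ) :=
  { c | ∃ a₁ b₁ c₁ : ℝ, 0 ≤ b₁ ∧ 0 ≤ c₁ ∧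
      c = ![(-a₁ - c₁, 0), (-a₁, 0), ((2*a₁ + c₁)/2, b₁), ((2*a₁ + c₁)/2, -b₁)] }

/-- The ending boundary configuration set `Q_{E₁}`. -/
def QE1set (θ : ℝ) : Set (Fin 4 → ℝ × ℝ) :=
  { c | ∃ a₂ b₂ c₂ : ℝ, 0 ≤ b₂ ∧ 0 ≤ c₂ ∧
      c = fun i => rotV θ (![(-b₂, -a₂), (-c₂, a₂), (c₂, a₂), (b₂, -a₂)] i) }

/-- The ending boundary configuration set `Q_{E₂}`. -/
def QE2set (θ : ℝ) : Set (Fin 4 → ℝ × ℝ) :=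
  { c | ∃ a₂ b₂ c₂ : ℝ, 0 ≤ b₂ ∧ 0 ≤ c₂ ∧
      c = fun i => rotV θ (![(-a₂, -b₂), (-a₂, b₂), (a₂, c₂), (a₂, -c₂)] i) }

/-- Membership in the admissible class `P(Q_S, E)`. -/
def inAdm (E : Set (Fin 4 → ℝ × ℝ)) (p : H1Path4) : Prop :=
  p.inChi ∧ p.q 0 ∈ QSset ∧ p.q 1 ∈ E

/-- `p` is an action minimizer over `P(Q_S, E)`. -/
def isMin (E : Set (Fin 4 → ℝ × ℝ)) (p : H1Path4) : Prop :=
  inAdm E p ∧ ∀ p' : H1Path4, inAdm E p' → action p ≤ action p'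

/-- The Newtonian equations of the equal-mass four-body problem, on a set `s`
of times. -/
def newton (Q : ℝ → Fin 4 → ℝ × ℝ) (s : Set ℝ) : Prop :=
  ∀ i : Fin 4, ∀ t ∈ s,
    deriv (deriv (fun u => Q u i)) t =
      ∑ j ∈ Finset.univ.erase i, (1 / enorm2 (Q t j - Q t i) ^ 3) • (Q t j - Q t i)

/-- A function whose increments are controlled by those of two absolutely continuous functions is
absolutely continuous. -/
lemma absolutelyContinuousOnInterval_of_dist_le {f g h : ℝ → ℝ} {a b K : ℝ}
    (hf : AbsolutelyContinuousOnInterval f a b) (hg : AbsolutelyContinuousOnInterval g a b)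
    (hh : ∀ s ∈ uIcc a b, ∀ t ∈ uIcc a b,
      dist (h s) (h t) ≤ K * (dist (f s) (f t) + dist (g s) (g t))) :
    AbsolutelyContinuousOnInterval h a b := by
  have hlim := (Filter.Tendsto.add hf hg).const_mul K
  rw [add_zero, mul_zero] at hlim
  unfold AbsolutelyContinuousOnInterval
  refine squeeze_zero' (.of_forall fun E => Finset.sum_nonneg fun i _ => dist_nonneg) ?_ hlim
  filter_upwards [Filter.mem_inf_of_right (Filter.mem_principal_self _)] with E hE
  rw [← Finset.sum_add_distrib, Finset.mul_sum]
  refine Finset.sum_le_sum fun i hi => ?_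
  exact hh _ (hE.1 i hi).1 _ (hE.1 i hi).2

/-- The calibration function of the planar Kepler problem, in the Levi-Civita time `s`. -/
def calib (κ δ s x y : ℝ) : ℝ :=
  κ * (y * cos (2 * κ * s) - x * sin (2 * κ * s)) +
    κ * (cos (2 * κ * s + δ) / sin (2 * κ * s + δ)) *
      (√(x ^ 2 + y ^ 2) - (x * cos (2 * κ * s) + y * sin (2 * κ * s)))

lemma calib_deriv_le {κ δ t vx vy : ℝ} {x y s : ℝ → ℝ} (hx : HasDerivAt x vx t)
    (hy : HasDerivAt y vy t) (hs : HasDerivAt s (1 / √(x t ^ 2 + y t ^ 2)) t)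
    (hr : 0 < √(x t ^ 2 + y t ^ 2)) (hsin : sin (2 * κ * s t + δ) ≠ 0) :
    ∃ D, HasDerivAt (fun t => calib κ δ (s t) (x t) (y t)) D t ∧
      κ ^ 2 + D ≤ (vx ^ 2 + vy ^ 2) / 4 := by
  have hr2 : x t ^ 2 + y t ^ 2 ≠ 0 := (Real.sqrt_pos.1 hr).ne'
  have hsq := Real.sq_sqrt (Real.sqrt_pos.1 hr).le
  have h2 : HasDerivAt (fun t => 2 * κ * s t) (2 * κ * (1 / √(x t ^ 2 + y t ^ 2))) t :=
    hs.const_mul _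
  have hC := h2.cos
  have hS := h2.sin
  have hK := (h2.add_const δ).cos.div (h2.add_const δ).sin hsin
  have hR := ((hx.pow 2).add (hy.pow 2)).sqrt hr2
  have hG := (((hy.mul hC).sub (hx.mul hS)).const_mul κ).add
    ((hK.const_mul κ).mul (hR.sub ((hx.mul hC).add (hy.mul hS))))
  refine ⟨_, hG, ?_⟩
  simp only [Pi.add_apply, Pi.pow_apply, Pi.sub_apply, Pi.mul_apply, Pi.div_apply]
  have e0 := sin_sq_add_cos_sq (2 * κ * s t + δ)
  have e1 := sin_sq_add_cos_sq (2 * κ * s t)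
  generalize hr' : √(x t ^ 2 + y t ^ 2) = r at *
  generalize sin (2 * κ * s t + δ) = S0 at *
  generalize cos (2 * κ * s t + δ) = C0 at *
  generalize sin (2 * κ * s t) = S at *
  generalize cos (2 * κ * s t) = C at *
  obtain ⟨n, hn⟩ : ∃ n, n = x t / r := ⟨_, rfl⟩
  obtain ⟨m, hm⟩ : ∃ m, m = y t / r := ⟨_, rfl⟩
  obtain ⟨K, hKd⟩ : ∃ K, K = C0 / S0 := ⟨_, rfl⟩
  have hxn : x t = r * n := by rw [hn]; field_simp
  have hym : y t = r * m := by rw [hm]; field_simp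
  have hCK : C0 = K * S0 := by rw [hKd]; field_simp
  have e2 : n ^ 2 + m ^ 2 = 1 := by
    rw [hxn, hym] at hsq
    have : r ^ 2 * (n ^ 2 + m ^ 2 - 1) = 0 := by linarith
    rcases mul_eq_zero.1 this with h | h
    · exact absurd h (by positivity)
    · linarith
  rw [hxn, hym]
  have hD : (-(S0) * (2 * κ * (1 / r)) * S0 - C0 * (C0 * (2 * κ * (1 / r)))) / S0 ^ 2 =
      -(1 + K ^ 2) * (2 * κ) / r := by
    rw [hCK]; field_simp; ring
  rw [hD, ← hKd]
  have key : (vx ^ 2 + vy ^ 2) / 4 - κ ^ 2 -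
      (κ * (vy * C - 2 * κ * m * S - (vx * S + 2 * κ * n * C))
      + κ * (-(1 + K ^ 2) * (2 * κ)) * (1 - (n * C + m * S))
      + κ * K * (n * vx + m * vy - (vx * C - 2 * κ * n * S + (vy * S + 2 * κ * m * C)))) =
      ((vx * C + vy * S) / 2 - κ * K * (n * C + m * S - 1)) ^ 2 +
      ((vy * C - vx * S) / 2 - κ - κ * K * (m * C - n * S)) ^ 2 := by
    linear_combination (-(vx ^ 2 + vy ^ 2) / 4 + κ * K * (n * vx + m * vy)
      - κ ^ 2 * K ^ 2 * (n ^ 2 + m ^ 2)) * e1 - κ ^ 2 * K ^ 2 * e2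
  have key2 := add_nonneg (sq_nonneg ((vx * C + vy * S) / 2 - κ * K * (n * C + m * S - 1)))
    (sq_nonneg ((vy * C - vx * S) / 2 - κ - κ * K * (m * C - n * S)))
  rw [← key] at key2
  refine le_of_sub_nonneg (key2.trans_eq ?_)
  field_simp
  ring

lemma AbsolutelyContinuousOnInterval.lipschitzOn_comp {f s : ℝ → ℝ} {a b : ℝ} {I : Set ℝ}
    {K : NNReal} (hf : LipschitzOnWith K f I) (hs : AbsolutelyContinuousOnInterval s a b)
    (hI : ∀ t ∈ uIcc a b, s t ∈ I) : AbsolutelyContinuousOnInterval (fun t => f (s t)) a b := by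
  refine absolutelyContinuousOnInterval_of_dist_le (K := K) hs hs fun u hu t ht => ?_
  have := hf.dist_le_mul _ (hI u hu) _ (hI t ht)
  have h0 : 0 ≤ K * dist (s u) (s t) := by positivity
  nlinarith

lemma AbsolutelyContinuousOnInterval.sqrt_sq_add_sq {x y : ℝ → ℝ} {a b : ℝ}
    (hx : AbsolutelyContinuousOnInterval x a b) (hy : AbsolutelyContinuousOnInterval y a b) :
    AbsolutelyContinuousOnInterval (fun t => √(x t ^ 2 + y t ^ 2)) a b := by
  refine absolutelyContinuousOnInterval_of_dist_le (K := 1) hx hy fun u _ t _ => ?_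
  have h1 : ∀ z : ℂ, √(z.re ^ 2 + z.im ^ 2) = ‖z‖ := fun z => by
    rw [Complex.norm_def, Complex.normSq_apply]; congr 1; ring
  have e1 := h1 ⟨x u, y u⟩
  have e2 := h1 ⟨x t, y t⟩
  simp only at e1 e2
  rw [e1, e2, one_mul, Real.dist_eq, Real.dist_eq, Real.dist_eq]
  refine (abs_norm_sub_norm_le _ _).trans ((Complex.norm_le_abs_re_add_abs_im _).trans ?_)
  simp

lemma exists_lipschitzOnWith_cot_add (δ : ℝ) {u : ℝ} (hu : 0 < u) :
    ∃ K, LipschitzOnWith K (fun z : ℝ => cos (z + δ) / sin (z + δ)) (Icc (u - δ) (π - u - δ)) := by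
  refine ContDiffOn.exists_lipschitzOnWith (n := 1) ?_ one_ne_zero (convex_Icc _ _) isCompact_Icc
  refine ContDiffOn.div (by fun_prop) (by fun_prop) fun z hz => (sin_pos_of_pos_of_lt_pi ?_ ?_).ne'
  · linarith [hz.1]
  · linarith [hz.2]

lemma calib_energy_bound {κ δ u a b : ℝ} {x y s vx vy : ℝ → ℝ} (hab : a ≤ b)
    (hx : AbsolutelyContinuousOnInterval x a b) (hy : AbsolutelyContinuousOnInterval y a b)
    (hs : AbsolutelyContinuousOnInterval s a b)
    (hx' : ∀ᵐ t, t ∈ uIcc a b → HasDerivAt x (vx t) t)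
    (hy' : ∀ᵐ t, t ∈ uIcc a b → HasDerivAt y (vy t) t)
    (hs' : ∀ᵐ t, t ∈ uIcc a b → HasDerivAt s (1 / √(x t ^ 2 + y t ^ 2)) t)
    (hr : ∀ᵐ t, t ∈ uIcc a b → 0 < √(x t ^ 2 + y t ^ 2))
    (hv : IntervalIntegrable (fun t => vx t ^ 2 + vy t ^ 2) volume a b)
    (hδ : 0 < u) (hu : ∀ t ∈ uIcc a b, 2 * κ * s t + δ ∈ Icc u (π - u)) :
    κ ^ 2 * (b - a) + (calib κ δ (s b) (x b) (y b) - calib κ δ (s a) (x a) (y a)) ≤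
      (∫ t in a..b, (vx t ^ 2 + vy t ^ 2)) / 4 := by
  have hA : AbsolutelyContinuousOnInterval (fun t => 2 * κ * s t) a b := hs.const_mul _
  have hmem : ∀ t ∈ uIcc a b, 2 * κ * s t ∈ Icc (u - δ) (π - u - δ) := fun t ht => by
    have := hu t ht
    constructor <;> linarith [this.1, this.2]
  obtain ⟨K, hK⟩ := exists_lipschitzOnWith_cot_add δ hδ
  have hcot : AbsolutelyContinuousOnInterval
      (fun t => cos (2 * κ * s t + δ) / sin (2 * κ * s t + δ)) a b := by
    have := hA.lipschitzOn_comp hK hmem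
    exact this
  have hcos : AbsolutelyContinuousOnInterval (fun t => cos (2 * κ * s t)) a b :=
    hA.lipschitzOn_comp (f := cos) (I := univ) lipschitzWith_cos.lipschitzOnWith
      fun _ _ => mem_univ _
  have hsin : AbsolutelyContinuousOnInterval (fun t => sin (2 * κ * s t)) a b :=
    hA.lipschitzOn_comp (f := sin) (I := univ) lipschitzWith_sin.lipschitzOnWith
      fun _ _ => mem_univ _
  have hG : AbsolutelyContinuousOnInterval (fun t => calib κ δ (s t) (x t) (y t)) a b :=
    (((hy.fun_mul hcos).fun_sub (hx.fun_mul hsin)).const_mul κ).fun_add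
      ((hcot.const_mul κ).fun_mul ((hx.sqrt_sq_add_sq hy).fun_sub
        ((hx.fun_mul hcos).fun_add (hy.fun_mul hsin))))
  rw [← hG.integral_deriv_eq_sub]
  have hc : κ ^ 2 * (b - a) = ∫ t in a..b, κ ^ 2 := by simp; ring
  rw [hc, ← intervalIntegral.integral_add intervalIntegrable_const hG.intervalIntegrable_deriv,
    ← intervalIntegral.integral_div]
  refine intervalIntegral.integral_mono_ae_restrict hab
    (intervalIntegrable_const.add hG.intervalIntegrable_deriv) (hv.div_const 4) ?_
  rw [Filter.EventuallyLE, ae_restrict_iff' measurableSet_Icc]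
  filter_upwards [hx', hy', hs', hr] with t h1 h2 h3 h4 ht
  rw [← uIcc_of_le hab] at ht
  obtain ⟨D, hD, hle⟩ := calib_deriv_le (κ := κ) (δ := δ) (h1 ht) (h2 ht) (h3 ht) (h4 ht)
    (sin_pos_of_pos_of_lt_pi (by linarith [(hu t ht).1]) (by linarith [(hu t ht).2])).ne'
  rw [hD.deriv]
  exact hle

/-- A finite-action path of the planar Kepler problem on `[a, b]`, with a.e. derivative `w`. -/
structure KPath (ρ w : ℝ → ℂ) (a b : ℝ) : Prop where
  le : a ≤ b
  int : IntervalIntegrable w volume a b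
  rep : ∀ t ∈ Icc a b, ρ t = ρ a + ∫ s in a..t, w s
  sq : IntervalIntegrable (fun t => ‖w t‖ ^ 2) volume a b
  inv : IntervalIntegrable (fun t => 1 / ‖ρ t‖) volume a b
  ne : ∀ᵐ t, t ∈ Icc a b → ρ t ≠ 0

namespace KPath

variable {ρ w : ℝ → ℂ} {a b : ℝ}

lemma mono (h : KPath ρ w a b) {c d : ℝ} (hac : a ≤ c) (hcd : c ≤ d) (hdb : d ≤ b) :
    KPath ρ w c d := by
  have hsub : ∀ t ∈ Icc c d, t ∈ Icc a b := fun t ht => ⟨hac.trans ht.1, ht.2.trans hdb⟩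
  have hu : uIcc c d ⊆ uIcc a b := by rwa [uIcc_of_le hcd, uIcc_of_le h.le]
  have hi : ∀ t ∈ Icc a b, IntervalIntegrable w volume a t := fun t ht =>
    h.int.mono_set (by rw [uIcc_of_le ht.1, uIcc_of_le h.le]; exact Icc_subset_Icc_right ht.2)
  refine ⟨hcd, h.int.mono_set hu, fun t ht => ?_, h.sq.mono_set hu, h.inv.mono_set hu, ?_⟩
  · have hc : c ∈ Icc a b := ⟨hac, hcd.trans hdb⟩
    rw [h.rep t (hsub t ht), h.rep c hc,
      ← intervalIntegral.integral_interval_sub_left (hi t (hsub t ht)) (hi c hc)]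
    ring
  · filter_upwards [h.ne] with t ht hh using ht (hsub t hh)

lemma const_mul (h : KPath ρ w a b) {u : ℂ} (hu : ‖u‖ = 1) :
    KPath (fun t => u * ρ t) (fun t => u * w t) a b where
  le := h.le
  int := h.int.const_mul u
  rep t ht := by
    rw [intervalIntegral.integral_const_mul, h.rep t ht]; ring
  sq := by simpa [hu] using h.sq
  inv := by simpa [hu] using h.inv
  ne := by
    have : u ≠ 0 := by rintro rfl; simp at hu
    filter_upwards [h.ne] with t ht hh using mul_ne_zero this (ht hh)

lemma conj (h : KPath ρ w a b) :
    KPath (fun t => starRingEnd ℂ (ρ t)) (fun t => starRingEnd ℂ (w t)) a b where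
  le := h.le
  int := by
    have := h.int
    rw [intervalIntegrable_iff] at this ⊢
    exact Complex.conjCLE.toContinuousLinearMap.integrable_comp this
  rep t ht := by
    have := Complex.conjCLE.toContinuousLinearMap.intervalIntegral_comp_comm
      (h.int.mono_set (c := a) (d := t) (by
        rw [uIcc_of_le ht.1, uIcc_of_le h.le]; exact Icc_subset_Icc_right ht.2))
    simp only [ContinuousLinearEquiv.coe_coe, Complex.conjCLE_apply] at this
    rw [this, h.rep t ht, map_add]
  sq := by simpa using h.sq
  inv := by simpa using h.inv
  ne := by
    filter_upwards [h.ne] with t ht hh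
    simpa using ht hh

lemma reverse (h : KPath ρ w 0 1) : KPath (fun t => ρ (1 - t)) (fun t => -w (1 - t)) 0 1 where
  le := h.le
  int := by
    have := (h.int.comp_sub_left 1).symm.neg
    simpa [Pi.neg_def] using this
  rep t ht := by
    have ht' : 1 - t ∈ Icc (0 : ℝ) 1 := ⟨by linarith [ht.2], by linarith [ht.1]⟩
    have h1 : IntervalIntegrable w volume 0 (1 - t) := h.int.mono_set (by
        rw [uIcc_of_le ht'.1, uIcc_of_le h.le]; exact Icc_subset_Icc_right ht'.2)
    simp only [intervalIntegral.integral_neg, intervalIntegral.integral_comp_sub_left, sub_zero]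
    rw [h.rep _ ht', h.rep 1 (by simp), ← intervalIntegral.integral_interval_sub_left h.int h1]
    ring
  sq := by simpa using (h.sq.comp_sub_left 1).symm
  inv := by simpa using (h.inv.comp_sub_left 1).symm
  ne := by
    have : Filter.Tendsto (fun t : ℝ => 1 - t) (ae volume) (ae volume) :=
      (Measure.measurePreserving_sub_left volume 1).quasiMeasurePreserving.tendsto_ae
    filter_upwards [this.eventually h.ne] with t ht hh
    exact ht ⟨by linarith [hh.2], by linarith [hh.1]⟩

lemma ae_hasDerivAt (h : KPath ρ w a b) :
    ∀ᵐ t, t ∈ uIcc a b → HasDerivAt ρ (w t) t := by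
  have h₁ : ∀ᵐ x : ℝ, x ≠ a := by simp [ae_iff, measure_singleton]
  have h₂ : ∀ᵐ x : ℝ, x ≠ b := by simp [ae_iff, measure_singleton]
  filter_upwards [h.int.ae_hasDerivAt_integral, h₁, h₂] with t ht ha hb hh
  have hd := (ht hh a left_mem_uIcc).const_add (ρ a)
  rw [uIcc_of_le h.le] at hh
  refine hd.congr_of_eventuallyEq ?_
  filter_upwards [Icc_mem_nhds (lt_of_le_of_ne hh.1 ha.symm) (lt_of_le_of_ne hh.2 hb)] with s hs
  exact h.rep s hs

lemma ae_hasDerivAt_re (h : KPath ρ w a b) :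
    ∀ᵐ t, t ∈ uIcc a b → HasDerivAt (fun t => (ρ t).re) (w t).re t := by
  filter_upwards [h.ae_hasDerivAt] with t ht hh
  exact Complex.reCLM.hasFDerivAt.comp_hasDerivAt t (ht hh)

lemma ae_hasDerivAt_im (h : KPath ρ w a b) :
    ∀ᵐ t, t ∈ uIcc a b → HasDerivAt (fun t => (ρ t).im) (w t).im t := by
  filter_upwards [h.ae_hasDerivAt] with t ht hh
  exact Complex.imCLM.hasFDerivAt.comp_hasDerivAt t (ht hh)

lemma absolutelyContinuous_of_rep {x v : ℝ → ℝ} (hab : a ≤ b) (hv : IntervalIntegrable v volume a b)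
    (hx : ∀ t ∈ Icc a b, x t = x a + ∫ s in a..t, v s) : AbsolutelyContinuousOnInterval x a b := by
  have h := hv.absolutelyContinuousOnInterval_intervalIntegral (c := a) left_mem_uIcc
  refine absolutelyContinuousOnInterval_of_dist_le (K := 1) h h fun s hs t ht => ?_
  rw [uIcc_of_le hab] at hs ht
  rw [hx s hs, hx t ht, dist_add_left, one_mul]
  exact le_add_of_nonneg_left dist_nonneg

lemma intervalIntegrable_re (h : KPath ρ w a b) :
    IntervalIntegrable (fun t => (w t).re) volume a b := by
  have := h.int
  rw [intervalIntegrable_iff] at this ⊢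
  exact Complex.reCLM.integrable_comp this

lemma intervalIntegrable_im (h : KPath ρ w a b) :
    IntervalIntegrable (fun t => (w t).im) volume a b := by
  have := h.int
  rw [intervalIntegrable_iff] at this ⊢
  exact Complex.imCLM.integrable_comp this

lemma absolutelyContinuous_re (h : KPath ρ w a b) :
    AbsolutelyContinuousOnInterval (fun t => (ρ t).re) a b := by
  refine absolutelyContinuous_of_rep h.le h.intervalIntegrable_re fun t ht => ?_
  have := Complex.reCLM.intervalIntegral_comp_comm
      (h.int.mono_set (c := a) (d := t) (by
        rw [uIcc_of_le ht.1, uIcc_of_le h.le]; exact Icc_subset_Icc_right ht.2))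
  simp only [Complex.reCLM_apply] at this
  rw [this, h.rep t ht, Complex.add_re]

lemma absolutelyContinuous_im (h : KPath ρ w a b) :
    AbsolutelyContinuousOnInterval (fun t => (ρ t).im) a b := by
  refine absolutelyContinuous_of_rep h.le h.intervalIntegrable_im fun t ht => ?_
  have := Complex.imCLM.intervalIntegral_comp_comm
      (h.int.mono_set (c := a) (d := t) (by
        rw [uIcc_of_le ht.1, uIcc_of_le h.le]; exact Icc_subset_Icc_right ht.2))
  simp only [Complex.imCLM_apply] at this
  rw [this, h.rep t ht, Complex.add_im]

end KPath

lemma Complex.sqrt_re_sq_add_im_sq (z : ℂ) : √(z.re ^ 2 + z.im ^ 2) = ‖z‖ := by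
  rw [Complex.norm_def, Complex.normSq_apply]; congr 1; ring

namespace KPath

variable {ρ w : ℝ → ℂ} {a b : ℝ}

lemma absolutelyContinuous_norm (h : KPath ρ w a b) :
    AbsolutelyContinuousOnInterval (fun t => ‖ρ t‖) a b := by
  have := h.absolutelyContinuous_re.sqrt_sq_add_sq h.absolutelyContinuous_im
  simpa only [Complex.sqrt_re_sq_add_im_sq] using this

lemma norm_sq_le (h : KPath ρ w a b) :
    ∀ᵐ t, t ∈ uIcc a b → deriv (fun t => ‖ρ t‖) t ^ 2 ≤ ‖w t‖ ^ 2 := by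
  filter_upwards [h.ae_hasDerivAt_re, h.ae_hasDerivAt_im, h.ne] with t h1 h2 h3 ht
  have hne := h3 (uIcc_of_le h.le ▸ ht)
  have hpos : (ρ t).re ^ 2 + (ρ t).im ^ 2 ≠ 0 := by
    intro h0
    apply hne
    rw [← norm_eq_zero, ← Complex.sqrt_re_sq_add_im_sq, h0, Real.sqrt_zero]
  have hd := (((h1 ht).fun_pow 2).fun_add ((h2 ht).fun_pow 2)).sqrt hpos
  simp only [Complex.sqrt_re_sq_add_im_sq] at hd
  have hn : 0 < ‖ρ t‖ := norm_pos_iff.2 hne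
  rw [hd.deriv, div_pow, div_le_iff₀ (by positivity)]
  have e1 : ‖w t‖ ^ 2 = (w t).re ^ 2 + (w t).im ^ 2 := by
    rw [← Complex.normSq_eq_norm_sq, Complex.normSq_apply]; ring
  have e2 : ‖ρ t‖ ^ 2 = (ρ t).re ^ 2 + (ρ t).im ^ 2 := by
    rw [← Complex.normSq_eq_norm_sq, Complex.normSq_apply]; ring
  rw [mul_pow, e1, e2]
  norm_num
  nlinarith [sq_nonneg ((ρ t).re * (w t).im - (ρ t).im * (w t).re)]

/-- The radial path in a fixed direction. -/
lemma radial (h : KPath ρ w a b) {u : ℂ} (hu : ‖u‖ = 1) :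
    KPath (fun t => u * (‖ρ t‖ : ℂ)) (fun t => u * ((deriv (fun t => ‖ρ t‖) t : ℝ) : ℂ)) a b := by
  refine KPath.const_mul ?_ hu
  have hac := h.absolutelyContinuous_norm
  have hle := h.norm_sq_le
  refine ⟨h.le, ?_, fun t ht => ?_, ?_, by simpa using h.inv, by simpa using h.ne⟩
  · have := hac.intervalIntegrable_deriv
    rw [intervalIntegrable_iff] at this ⊢
    exact this.ofReal
  · rw [intervalIntegral.integral_ofReal, (hac.mono (c := a) (d := t) (by
      rw [uIcc_of_le ht.1, uIcc_of_le h.le]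
      exact Icc_subset_Icc_right ht.2)).integral_deriv_eq_sub]
    push_cast; ring
  · refine h.sq.mono_fun ?_ ?_
    · refine AEStronglyMeasurable.pow ?_ 2
      exact (measurable_deriv _).complex_ofReal.norm.aestronglyMeasurable
    · rw [Filter.EventuallyLE, ae_restrict_iff' measurableSet_uIoc]
      filter_upwards [hle] with t ht hh
      simpa using! ht (uIoc_subset_uIcc hh)

lemma radial_energy_le (h : KPath ρ w a b) {u : ℂ} (hu : ‖u‖ = 1) :
    ∫ t in a..b, ‖u * ((deriv (fun t => ‖ρ t‖) t : ℝ) : ℂ)‖ ^ 2 ≤ ∫ t in a..b, ‖w t‖ ^ 2 := by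
  refine intervalIntegral.integral_mono_ae_restrict h.le (h.radial hu).sq h.sq ?_
  rw [Filter.EventuallyLE, ae_restrict_iff' measurableSet_Icc]
  filter_upwards [h.norm_sq_le] with t ht hh
  simpa [hu] using ht (uIcc_of_le h.le ▸ hh)

end KPath

lemma calib_ray (κ δ s : ℝ) {r : ℝ} (hr : 0 ≤ r) :
    calib κ δ s (r * cos (2 * κ * s)) (r * sin (2 * κ * s)) = 0 := by
  have h : √((r * cos (2 * κ * s)) ^ 2 + (r * sin (2 * κ * s)) ^ 2) = r := by
    rw [show (r * cos (2 * κ * s)) ^ 2 + (r * sin (2 * κ * s)) ^ 2 = r ^ 2 by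
      linear_combination r ^ 2 * sin_sq_add_cos_sq (2 * κ * s), Real.sqrt_sq hr]
  rw [calib, h]
  linear_combination (-κ * (cos (2 * κ * s + δ) / sin (2 * κ * s + δ)) * r) *
    sin_sq_add_cos_sq (2 * κ * s)

/-- The calibration inequality satisfied by any Kepler path from `x` to `y` of duration `T`, with
energy integral `I` and Levi-Civita time `S`. -/
def Link (x y : ℂ) (T I S : ℝ) : Prop :=
  0 ≤ S ∧ ∀ κ δ u : ℝ, 0 ≤ κ → 0 < 2 * κ * u + δ → 2 * κ * (u + S) + δ < π →
    κ ^ 2 * T + (calib κ δ (u + S) y.re y.im - calib κ δ u x.re x.im) ≤ I / 4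

lemma Link.trans {x y z : ℂ} {T T' I I' S S' : ℝ} (h : Link x y T I S) (h' : Link y z T' I' S') :
    Link x z (T + T') (I + I') (S + S') := by
  refine ⟨add_nonneg h.1 h'.1, fun κ δ u hκ h0 h1 => ?_⟩
  have hS := mul_nonneg hκ h.1
  have hS' := mul_nonneg hκ h'.1
  have a := h.2 κ δ u hκ h0 (by nlinarith)
  have b := h'.2 κ δ (u + S) hκ (by nlinarith) (by nlinarith)
  rw [← add_assoc]
  linarith

lemma Link.mono {x y : ℂ} {T I I' S : ℝ} (h : Link x y T I S) (hI : I ≤ I') :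
    Link x y T I' S :=
  ⟨h.1, fun κ δ u a b c => (h.2 κ δ u a b c).trans (by linarith)⟩

/-- A Kepler path turning by an angle `φ < π` around the origin satisfies `φ² T ≤ I S²`. -/
lemma Link.sq_mul_le {φ x y T I S : ℝ} (hφ0 : 0 < φ) (hφ : φ < π) (hx : 0 ≤ x) (hy : 0 ≤ y)
    (hS : 0 < S) (h : Link x (y * Complex.exp (φ * Complex.I)) T I S) : φ ^ 2 * T ≤ I * S ^ 2 := by
  have hκ : 2 * (φ / (2 * S)) * S = φ := by field_simp
  have := h.2 (φ / (2 * S)) ((π - φ) / 2) 0 (by positivity) (by linarith) (by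
    rw [zero_add, hκ]; linarith)
  have e1 := calib_ray (φ / (2 * S)) ((π - φ) / 2) 0 hx
  have e2 := calib_ray (φ / (2 * S)) ((π - φ) / 2) S hy
  rw [hκ] at e2
  simp only [mul_zero, cos_zero, mul_one, sin_zero] at e1
  simp only [zero_add, Complex.ofReal_re, Complex.ofReal_im, Complex.re_ofReal_mul,
    Complex.im_ofReal_mul, Complex.exp_ofReal_mul_I_re, Complex.exp_ofReal_mul_I_im] at this
  rw [e1, e2, div_pow] at this
  have h3 : φ ^ 2 / (2 * S) ^ 2 * T = φ ^ 2 * T / (4 * S ^ 2) := by ring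
  rw [h3, sub_zero, add_zero, div_le_iff₀ (by positivity)] at this
  linarith

lemma three_halves_mul_le {c I S m : ℝ} (hc : 0 ≤ c) (hS : 0 < S) (h : 4 * c ^ 3 ≤ m)
    (hm : m ≤ I * S ^ 2) : 3 / 2 * c ≤ I / 8 + S := by
  have h1 : 4 * c ^ 3 / S ^ 2 ≤ I := by rw [div_le_iff₀ (by positivity)]; linarith
  have h2 : 3 / 2 * c ≤ (4 * c ^ 3 / S ^ 2) / 8 + S := by
    rw [div_div, ← sub_nonneg]
    have : 4 * c ^ 3 / (S ^ 2 * 8) + S - 3 / 2 * c = (c - S) ^ 2 * (c + 2 * S) / (2 * S ^ 2) := by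
      field_simp; ring
    rw [this]; positivity
  linarith

/-- A link between two radii realised along every ray. -/
def NormLink (x y : ℝ) (T I S : ℝ) : Prop := ∀ u : ℂ, ‖u‖ = 1 → Link (u * x) (u * y) T I S

/-- A link between two radii whose direction may change arbitrarily (through a collision). -/
def CollLink (x y : ℝ) (T I S : ℝ) : Prop :=
  ∀ u u' : ℂ, ‖u‖ = 1 → ‖u'‖ = 1 → Link (u * x) (u' * y) T I S

lemma CollLink.trans_norm {x y z : ℝ} {T T' I I' S S' : ℝ} (h : CollLink x y T I S)
    (h' : NormLink y z T' I' S') : CollLink x z (T + T') (I + I') (S + S') :=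
  fun u u' hu hu' => (h u u' hu hu').trans (h' u' hu')

lemma NormLink.trans {x y z : ℝ} {T T' I I' S S' : ℝ} (h : NormLink x y T I S)
    (h' : NormLink y z T' I' S') : NormLink x z (T + T') (I + I') (S + S') :=
  fun u hu => (h u hu).trans (h' u hu)

lemma NormLink.trans_coll {x y z : ℝ} {T T' I I' S S' : ℝ} (h : NormLink x y T I S)
    (h' : CollLink y z T' I' S') : CollLink x z (T + T') (I + I') (S + S') :=
  fun u u' hu hu' => (h u hu).trans (h' u u' hu hu')

lemma CollLink.sq_mul_le {φ x y T I S : ℝ} (h : CollLink x y T I S) (hφ0 : 0 < φ) (hφ : φ < π)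
    (hx : 0 ≤ x) (hy : 0 ≤ y) (hS : 0 < S) : φ ^ 2 * T ≤ I * S ^ 2 := by
  refine Link.sq_mul_le (x := x) (y := y) hφ0 hφ hx hy hS ?_
  have := h 1 (Complex.exp (φ * Complex.I)) (by simp) (Complex.norm_exp_ofReal_mul_I φ)
  rwa [one_mul, mul_comm (Complex.exp _)] at this

namespace KPath

variable {ρ w : ℝ → ℂ} {a b : ℝ}

lemma inv_nonneg (h : KPath ρ w a b) : 0 ≤ ∫ t in a..b, 1 / ‖ρ t‖ :=
  intervalIntegral.integral_nonneg_of_forall h.le fun _ => by positivity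

lemma inv_pos (h : KPath ρ w a b) (hab : a < b) : 0 < ∫ t in a..b, 1 / ‖ρ t‖ := by
  rw [intervalIntegral.integral_pos_iff_support_of_nonneg_ae' _ h.inv]
  · refine ⟨hab, ?_⟩
    have : volume (Ioc a b) ≤ volume ((Function.support fun t => 1 / ‖ρ t‖) ∩ Ioc a b) := by
      refine measure_mono_ae ?_
      filter_upwards [h.ne] with t ht hh
      exact ⟨by simpa using ht (Ioc_subset_Icc_self hh), hh⟩
    refine lt_of_lt_of_le ?_ this
    simpa using hab
  · exact .of_forall fun _ => by simp

lemma link (h : KPath ρ w a b) :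
    Link (ρ a) (ρ b) (b - a) (∫ t in a..b, ‖w t‖ ^ 2) (∫ t in a..b, 1 / ‖ρ t‖) := by
  refine ⟨h.inv_nonneg, fun κ δ u hκ h0 h1 => ?_⟩
  set S := ∫ t in a..b, 1 / ‖ρ t‖
  have hii : ∀ t ∈ Icc a b, IntervalIntegrable (fun t => 1 / ‖ρ t‖) volume a t := fun t ht =>
    h.inv.mono_set (by rw [uIcc_of_le ht.1, uIcc_of_le h.le]; exact Icc_subset_Icc_right ht.2)
  have hs : AbsolutelyContinuousOnInterval (fun t => u + ∫ s in a..t, 1 / ‖ρ s‖) a b :=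
    absolutelyContinuous_of_rep h.le h.inv fun t ht => by simp
  have hs' : ∀ᵐ t, t ∈ uIcc a b → HasDerivAt (fun t => u + ∫ s in a..t, 1 / ‖ρ s‖)
      (1 / √((ρ t).re ^ 2 + (ρ t).im ^ 2)) t := by
    filter_upwards [h.inv.ae_hasDerivAt_integral] with t ht hh
    rw [Complex.sqrt_re_sq_add_im_sq]
    exact (ht hh a left_mem_uIcc).const_add u
  have hr : ∀ᵐ t, t ∈ uIcc a b → 0 < √((ρ t).re ^ 2 + (ρ t).im ^ 2) := by
    filter_upwards [h.ne] with t ht hh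
    rw [Complex.sqrt_re_sq_add_im_sq]
    exact norm_pos_iff.2 (ht (uIcc_of_le h.le ▸ hh))
  have hw : ∀ t, (w t).re ^ 2 + (w t).im ^ 2 = ‖w t‖ ^ 2 := fun t => by
    rw [← Complex.normSq_eq_norm_sq, Complex.normSq_apply]; ring
  have hSt : ∀ t ∈ uIcc a b, 0 ≤ (∫ s in a..t, 1 / ‖ρ s‖) ∧ (∫ s in a..t, 1 / ‖ρ s‖) ≤ S := by
    intro t ht
    rw [uIcc_of_le h.le] at ht
    refine ⟨intervalIntegral.integral_nonneg_of_forall ht.1 fun _ => by positivity, ?_⟩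
    refine intervalIntegral.integral_mono_interval le_rfl ht.1 ht.2 ?_ h.inv
    exact .of_forall fun _ => by simp
  have key := calib_energy_bound (κ := κ) (δ := δ)
    (u := min (2 * κ * u + δ) (π - (2 * κ * (u + S) + δ))) h.le
    h.absolutelyContinuous_re h.absolutelyContinuous_im hs h.ae_hasDerivAt_re h.ae_hasDerivAt_im
    hs' hr (by simpa only [hw] using h.sq) (lt_min h0 (by linarith)) fun t ht => by
      obtain ⟨p1, p2⟩ := hSt t ht
      have q1 := mul_nonneg hκ p1
      have q2 := mul_le_mul_of_nonneg_left p2 hκ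
      refine ⟨(min_le_left _ _).trans (by nlinarith), ?_⟩
      have := min_le_right (2 * κ * u + δ) (π - (2 * κ * (u + S) + δ))
      nlinarith
  simpa only [hw, intervalIntegral.integral_same, add_zero] using key

lemma normLink (h : KPath ρ w a b) :
    NormLink ‖ρ a‖ ‖ρ b‖ (b - a) (∫ t in a..b, ‖w t‖ ^ 2) (∫ t in a..b, 1 / ‖ρ t‖) := by
  intro u hu
  have := (h.radial hu).link.mono (h.radial_energy_le hu)
  simpa [hu] using this

lemma collLink (h : KPath ρ w a b) {c : ℝ} (hc : c ∈ Icc a b) (h0 : ρ c = 0) :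
    CollLink ‖ρ a‖ ‖ρ b‖ (b - a) (∫ t in a..b, ‖w t‖ ^ 2) (∫ t in a..b, 1 / ‖ρ t‖) := by
  intro u u' hu hu'
  have h1 := h.mono le_rfl hc.1 hc.2
  have h2 := h.mono hc.1 hc.2 le_rfl
  have l1 := h1.normLink u hu
  have l2 := h2.normLink u' hu'
  rw [h0, norm_zero, Complex.ofReal_zero, mul_zero] at l1 l2
  have := l1.trans l2
  rwa [intervalIntegral.integral_add_adjacent_intervals h1.sq h2.sq,
    intervalIntegral.integral_add_adjacent_intervals h1.inv h2.inv,
    show c - a + (b - c) = b - a by ring] at this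

end KPath

/-- The identification of `ℝ × ℝ` with the complex plane. -/
abbrev toC : (ℝ × ℝ) →L[ℝ] ℂ := Complex.equivRealProdCLM.symm

lemma toC_re (v : ℝ × ℝ) : (toC v).re = v.1 := rfl

lemma toC_im (v : ℝ × ℝ) : (toC v).im = v.2 := rfl

lemma norm_toC (v : ℝ × ℝ) : ‖toC v‖ = enorm2 v := by
  rw [← Complex.sqrt_re_sq_add_im_sq, toC_re, toC_im, enorm2]

lemma enorm2_nonneg (v : ℝ × ℝ) : 0 ≤ enorm2 v := Real.sqrt_nonneg _

lemma enorm2_sub_comm (v w : ℝ × ℝ) : enorm2 (v - w) = enorm2 (w - v) := by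
  rw [← norm_toC, ← norm_toC, map_sub, map_sub, norm_sub_rev]

lemma enorm2_eq_zero {v : ℝ × ℝ} : enorm2 v = 0 ↔ v = 0 := by
  rw [← norm_toC, norm_eq_zero]
  exact map_eq_zero_iff toC Complex.equivRealProdCLM.symm.injective

lemma enorm2_sq (v : ℝ × ℝ) : enorm2 v ^ 2 = v.1 ^ 2 + v.2 ^ 2 :=
  Real.sq_sqrt (by positivity)

lemma continuous_enorm2 : Continuous enorm2 := by
  unfold enorm2; fun_prop

namespace H1Path4

variable (p : H1Path4)

lemma intervalIntegrable_v (i : Fin 4) : IntervalIntegrable (fun t => p.v t i) volume 0 1 := by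
  rw [intervalIntegrable_iff_integrableOn_Icc_of_le zero_le_one]
  exact p.hvInt i

lemma continuousOn_q (i : Fin 4) : ContinuousOn (fun t => p.q t i) (Icc 0 1) := by
  have h := intervalIntegral.continuousOn_primitive_interval (μ := volume)
    (f := fun t => p.v t i) (a := 0) (b := 1) (by simpa using p.hvInt i)
  rw [uIcc_of_le zero_le_one] at h
  exact (continuousOn_const.add h).congr fun t ht => p.hrep i t ht

lemma memLp_v (i : Fin 4) : MemLp (fun t => toC (p.v t i)) 2 (volume.restrict (Icc 0 1)) := by
  rw [memLp_two_iff_integrable_sq_norm]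
  · simpa only [norm_toC] using! p.hL2 i
  · exact toC.continuous.comp_aestronglyMeasurable (p.hvInt i).aestronglyMeasurable

/-- The potential of `p` is integrable on `[0, 1]`. -/
def FinitePotential : Prop :=
  ∀ i j : Fin 4, i < j → IntegrableOn (fun t => 1 / enorm2 (p.q t i - p.q t j)) (Icc 0 1) ∧
    ∀ᵐ t ∂volume.restrict (Icc 0 1), 0 < enorm2 (p.q t i - p.q t j)

/-- The real-valued action of a path with integrable potential. -/
def realAction : ℝ :=
  (∫ t in Icc (0 : ℝ) 1, (1 / 2) * ∑ i, enorm2 (p.v t i) ^ 2) +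
    ∑ i : Fin 4, ∑ j ∈ Finset.univ.filter (fun j => i < j),
      ∫ t in Icc (0 : ℝ) 1, 1 / enorm2 (p.q t i - p.q t j)

variable {p}

lemma realAction_nonneg : 0 ≤ p.realAction := by
  refine add_nonneg (integral_nonneg fun _ => by positivity) ?_
  exact Finset.sum_nonneg fun i _ => Finset.sum_nonneg fun j _ =>
    integral_nonneg fun _ => div_nonneg zero_le_one (enorm2_nonneg _)

lemma aemeasurable_inv (i j : Fin 4) :
    AEMeasurable (fun t => (ENNReal.ofReal (enorm2 (p.q t i - p.q t j)))⁻¹)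
      (volume.restrict (Icc 0 1)) := by
  have h := continuous_enorm2.comp_continuousOn ((p.continuousOn_q i).sub (p.continuousOn_q j))
  exact (h.aemeasurable measurableSet_Icc).ennreal_ofReal.inv

lemma aemeasurable_kinetic :
    AEMeasurable (fun t => ENNReal.ofReal ((1/2) * ∑ i, enorm2 (p.v t i) ^ 2))
      (volume.restrict (Icc 0 1)) :=
  ((integrable_finsetSum _ fun i _ => p.hL2 i).const_mul _).aemeasurable.ennreal_ofReal

lemma action_eq_add : action p =
    (∫⁻ t in Icc (0:ℝ) 1, ENNReal.ofReal ((1/2) * ∑ i, enorm2 (p.v t i) ^ 2)) +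
      ∑ i : Fin 4, ∑ j ∈ Finset.univ.filter (fun j => i < j),
        ∫⁻ t in Icc (0:ℝ) 1, (ENNReal.ofReal (enorm2 (p.q t i - p.q t j)))⁻¹ := by
  rw [action, lintegral_add_left' aemeasurable_kinetic, lintegral_finsetSum']
  · congr 1
    refine Finset.sum_congr rfl fun i _ => ?_
    exact lintegral_finsetSum' _ fun j _ => aemeasurable_inv i j
  · exact fun i _ => Finset.aemeasurable_fun_sum _ fun j _ => aemeasurable_inv i j

lemma finitePotential_of_action_ne_top (h : action p ≠ ⊤) : p.FinitePotential := by
  intro i j hij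
  rw [action_eq_add, ENNReal.add_ne_top, ENNReal.sum_ne_top] at h
  have h1 := ENNReal.sum_ne_top.1 (h.2 i (Finset.mem_univ i)) j (by simpa using hij)
  have h2 := ae_lt_top' (aemeasurable_inv i j) h1
  have hpos : ∀ᵐ t ∂volume.restrict (Icc 0 1), 0 < enorm2 (p.q t i - p.q t j) := by
    filter_upwards [h2] with t ht
    by_contra hc
    rw [ENNReal.ofReal_of_nonpos (not_lt.1 hc)] at ht
    simp at ht
  refine ⟨⟨?_, ?_⟩, hpos⟩
  · have h := continuous_enorm2.comp_continuousOn ((p.continuousOn_q i).sub (p.continuousOn_q j))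
    simpa using! (h.aemeasurable measurableSet_Icc).inv.aestronglyMeasurable
  · rw [hasFiniteIntegral_iff_ofReal (.of_forall fun t => div_nonneg zero_le_one (enorm2_nonneg _)),
      lt_top_iff_ne_top]
    convert h1 using 1
    refine lintegral_congr_ae ?_
    filter_upwards [hpos] with t ht
    rw [one_div, ENNReal.ofReal_inv_of_pos ht]

lemma FinitePotential.action_eq (h : p.FinitePotential) :
    action p = ENNReal.ofReal p.realAction := by
  rw [action_eq_add, realAction, ENNReal.ofReal_add (integral_nonneg fun _ => by positivity),
    ← ofReal_integral_eq_lintegral_ofReal, ENNReal.ofReal_sum_of_nonneg]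
  · congr 1
    refine Finset.sum_congr rfl fun i _ => ?_
    rw [ENNReal.ofReal_sum_of_nonneg]
    · refine Finset.sum_congr rfl fun j hj => ?_
      obtain ⟨h1, h2⟩ := h i j (by simpa using hj)
      rw [ofReal_integral_eq_lintegral_ofReal h1
        (.of_forall fun t => div_nonneg zero_le_one (enorm2_nonneg _))]
      refine lintegral_congr_ae ?_
      filter_upwards [h2] with t ht
      rw [one_div, ENNReal.ofReal_inv_of_pos ht]
    · exact fun j _ => integral_nonneg fun _ => div_nonneg zero_le_one (enorm2_nonneg _)
  · exact fun i _ => Finset.sum_nonneg fun j _ =>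
      integral_nonneg fun _ => div_nonneg zero_le_one (enorm2_nonneg _)
  · exact (integrable_finsetSum _ fun i _ => p.hL2 i).const_mul _
  · exact .of_forall fun _ => by positivity
  · exact Finset.sum_nonneg fun i _ => Finset.sum_nonneg fun j _ =>
      integral_nonneg fun _ => div_nonneg zero_le_one (enorm2_nonneg _)

variable (p) in
/-- The relative position of bodies `i` and `j`, as a complex number. -/
def rel (i j : Fin 4) (t : ℝ) : ℂ := toC (p.q t j - p.q t i)

variable (p) in
/-- The relative velocity of bodies `i` and `j`, as a complex number. -/
def relV (i j : Fin 4) (t : ℝ) : ℂ := toC (p.v t j - p.v t i)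

lemma norm_rel (i j : Fin 4) (t : ℝ) : ‖p.rel i j t‖ = enorm2 (p.q t i - p.q t j) := by
  rw [rel, norm_toC, enorm2_sub_comm]

lemma norm_relV (i j : Fin 4) (t : ℝ) : ‖p.relV i j t‖ = enorm2 (p.v t i - p.v t j) := by
  rw [relV, norm_toC, enorm2_sub_comm]

lemma FinitePotential.kpath (h : p.FinitePotential) {i j : Fin 4} (hij : i < j) :
    KPath (p.rel i j) (p.relV i j) 0 1 where
  le := zero_le_one
  int := by
    have := (p.intervalIntegrable_v j).sub (p.intervalIntegrable_v i)
    rw [intervalIntegrable_iff] at this ⊢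
    exact toC.integrable_comp this
  rep t ht := by
    have hs : uIcc 0 t ⊆ uIcc (0 : ℝ) 1 := by
      rw [uIcc_of_le ht.1, uIcc_of_le zero_le_one]; exact Icc_subset_Icc_right ht.2
    have hi := (p.intervalIntegrable_v i).mono_set hs
    have hj := (p.intervalIntegrable_v j).mono_set hs
    simp only [rel, relV]
    rw [toC.intervalIntegral_comp_comm (hj.sub hi), intervalIntegral.integral_sub hj hi,
      p.hrep i t ht, p.hrep j t ht, ← map_add]
    congr 1; abel
  sq := by
    rw [intervalIntegrable_iff_integrableOn_Icc_of_le zero_le_one]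
    have := ((p.memLp_v j).sub (p.memLp_v i)).integrable_norm_pow (by norm_num)
    simpa only [relV, map_sub] using! this
  inv := by
    rw [intervalIntegrable_iff_integrableOn_Icc_of_le zero_le_one]
    simpa only [norm_rel] using (h i j hij).1
  ne := by
    have := (ae_restrict_iff' measurableSet_Icc).1 (h i j hij).2
    filter_upwards [this] with t ht hh
    rw [← norm_pos_iff, norm_rel]
    exact ht hh

lemma sum_enorm2_sub_sq_le (v : Fin 4 → ℝ × ℝ) :
    ∑ i : Fin 4, ∑ j ∈ Finset.univ.filter (fun j => i < j), enorm2 (v i - v j) ^ 2 ≤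
      4 * ∑ i, enorm2 (v i) ^ 2 := by
  simp only [enorm2_sq, Finset.sum_filter, Fin.sum_univ_four, Prod.fst_sub, Prod.snd_sub,
    Fin.isValue, Fin.reduceLT, lt_self_iff_false, if_true, if_false]
  nlinarith [sq_nonneg ((v 0).1 + (v 1).1 + (v 2).1 + (v 3).1),
    sq_nonneg ((v 0).2 + (v 1).2 + (v 2).2 + (v 3).2)]

variable (p) in
/-- The energy integral of the relative motion of bodies `i` and `j`. -/
abbrev relEnergy (i j : Fin 4) : ℝ := ∫ t in (0 : ℝ)..1, ‖p.relV i j t‖ ^ 2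

variable (p) in
/-- The Levi-Civita time of the relative motion of bodies `i` and `j`. -/
abbrev relTime (i j : Fin 4) : ℝ := ∫ t in (0 : ℝ)..1, 1 / ‖p.rel i j t‖

variable (p) in
/-- The Kepler action of the relative motion of bodies `i` and `j`. -/
def pairAction (i j : Fin 4) : ℝ := p.relEnergy i j / 8 + p.relTime i j

lemma FinitePotential.sum_pairAction_le (h : p.FinitePotential) :
    ∑ i : Fin 4, ∑ j ∈ Finset.univ.filter (fun j => i < j), p.pairAction i j ≤ p.realAction := by
  simp only [pairAction, realAction, Finset.sum_add_distrib]
  refine add_le_add ?_ (le_of_eq ?_)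
  · have hint : ∀ i j, i < j → IntegrableOn (fun t => ‖p.relV i j t‖ ^ 2 / 8) (Icc 0 1) :=
      fun i j hij => by
        have := (h.kpath hij).sq
        rw [intervalIntegrable_iff_integrableOn_Icc_of_le zero_le_one] at this
        exact this.div_const 8
    have e : ∑ i : Fin 4, ∑ j ∈ Finset.univ.filter (fun j => i < j),
        (∫ t in (0 : ℝ)..1, ‖p.relV i j t‖ ^ 2) / 8 = ∫ t in Icc (0 : ℝ) 1,
        ∑ i : Fin 4, ∑ j ∈ Finset.univ.filter (fun j => i < j), ‖p.relV i j t‖ ^ 2 / 8 := by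
      rw [integral_finsetSum]
      · refine Finset.sum_congr rfl fun i _ => ?_
        rw [integral_finsetSum]
        · refine Finset.sum_congr rfl fun j _ => ?_
          rw [integral_div, intervalIntegral.integral_of_le zero_le_one,
            integral_Icc_eq_integral_Ioc]
        · exact fun j hj => hint i j (by simpa using hj)
      · exact fun i _ => integrable_finsetSum _ fun j hj => hint i j (by simpa using hj)
    rw [e]
    refine integral_mono ?_ ?_ fun t => ?_
    · exact integrable_finsetSum _ fun i _ => integrable_finsetSum _ fun j hj =>
        hint i j (by simpa using hj)
    · exact (integrable_finsetSum _ fun i _ => p.hL2 i).const_mul _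
    · have := sum_enorm2_sub_sq_le (p.v t)
      simp only [norm_relV, ← Finset.sum_div]
      linarith
  · refine Finset.sum_congr rfl fun i _ => Finset.sum_congr rfl fun j _ => ?_
    rw [relTime, intervalIntegral.integral_of_le zero_le_one, integral_Icc_eq_integral_Ioc]
    simp only [norm_rel]

end H1Path4

namespace KPath

variable {ρ w : ℝ → ℂ}

lemma link_mul (h : KPath ρ w 0 1) {u : ℂ} (hu : ‖u‖ = 1) :
    Link (u * ρ 0) (u * ρ 1) 1 (∫ t in (0 : ℝ)..1, ‖w t‖ ^ 2) (∫ t in (0 : ℝ)..1, 1 / ‖ρ t‖) := by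
  simpa [hu] using (h.const_mul hu).link

lemma link_reverse_conj (h : KPath ρ w 0 1) {u : ℂ} (hu : ‖u‖ = 1) :
    Link (u * starRingEnd ℂ (ρ 1)) (u * starRingEnd ℂ (ρ 0)) 1 (∫ t in (0 : ℝ)..1, ‖w t‖ ^ 2)
      (∫ t in (0 : ℝ)..1, 1 / ‖ρ t‖) := by
  have h1 := intervalIntegral.integral_comp_sub_left (fun t => ‖w t‖ ^ 2) (1 : ℝ) (a := 0) (b := 1)
  have h2 := intervalIntegral.integral_comp_sub_left (fun t => ‖ρ t‖⁻¹) (1 : ℝ) (a := 0) (b := 1)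
  simp only [sub_self, sub_zero] at h1 h2
  simpa [h1, h2] using h.reverse.conj.link_mul hu

lemma normLink_reverse (h : KPath ρ w 0 1) :
    NormLink ‖ρ 1‖ ‖ρ 0‖ 1 (∫ t in (0 : ℝ)..1, ‖w t‖ ^ 2) (∫ t in (0 : ℝ)..1, 1 / ‖ρ t‖) := by
  have h1 := intervalIntegral.integral_comp_sub_left (fun t => ‖w t‖ ^ 2) (1 : ℝ) (a := 0) (b := 1)
  have h2 := intervalIntegral.integral_comp_sub_left (fun t => ‖ρ t‖⁻¹) (1 : ℝ) (a := 0) (b := 1)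
  simp only [sub_self, sub_zero] at h1 h2
  simpa [h1, h2] using h.reverse.normLink

lemma collLink_reverse (h : KPath ρ w 0 1) {c : ℝ} (hc : c ∈ Icc (0 : ℝ) 1) (h0 : ρ c = 0) :
    CollLink ‖ρ 1‖ ‖ρ 0‖ 1 (∫ t in (0 : ℝ)..1, ‖w t‖ ^ 2) (∫ t in (0 : ℝ)..1, 1 / ‖ρ t‖) := by
  have h1 := intervalIntegral.integral_comp_sub_left (fun t => ‖w t‖ ^ 2) (1 : ℝ) (a := 0) (b := 1)
  have h2 := intervalIntegral.integral_comp_sub_left (fun t => ‖ρ t‖⁻¹) (1 : ℝ) (a := 0) (b := 1)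
  simp only [sub_self, sub_zero] at h1 h2
  simpa [h1, h2] using h.reverse.collLink (c := 1 - c) ⟨by linarith [hc.2], by linarith [hc.1]⟩
    (by simpa using h0)

lemma normLink_one (h : KPath ρ w 0 1) :
    NormLink ‖ρ 0‖ ‖ρ 1‖ 1 (∫ t in (0 : ℝ)..1, ‖w t‖ ^ 2) (∫ t in (0 : ℝ)..1, 1 / ‖ρ t‖) := by
  simpa using h.normLink

lemma collLink_one (h : KPath ρ w 0 1) {c : ℝ} (hc : c ∈ Icc (0 : ℝ) 1) (h0 : ρ c = 0) :
    CollLink ‖ρ 0‖ ‖ρ 1‖ 1 (∫ t in (0 : ℝ)..1, ‖w t‖ ^ 2) (∫ t in (0 : ℝ)..1, 1 / ‖ρ t‖) := by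
  simpa using h.collLink hc h0

end KPath

lemma toC_rotV (θ : ℝ) (v : ℝ × ℝ) : toC (rotV θ v) = Complex.exp (θ * Complex.I) * toC v := by
  apply Complex.ext
  · rw [Complex.mul_re, Complex.exp_ofReal_mul_I_re, Complex.exp_ofReal_mul_I_im]
    simp only [toC_re, toC_im, rotV]; ring
  · rw [Complex.mul_im, Complex.exp_ofReal_mul_I_re, Complex.exp_ofReal_mul_I_im]
    simp only [toC_re, toC_im, rotV]; ring

lemma exp_mul_conj_exp (θ : ℝ) :
    Complex.exp (θ * Complex.I) * starRingEnd ℂ (Complex.exp (θ * Complex.I)) = 1 := by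
  rw [Complex.mul_conj, Complex.normSq_eq_norm_sq, Complex.norm_exp_ofReal_mul_I]; simp

namespace H1Path4

variable {p : H1Path4} {θ : ℝ}

lemma rel_start (h : p.q 0 ∈ QSset) : ∃ b c : ℝ, 0 ≤ b ∧ 0 ≤ c ∧ p.rel 0 1 0 = c ∧
    p.rel 2 3 0 = -(b * Complex.I) ∧ p.rel 0 3 0 = starRingEnd ℂ (p.rel 0 2 0) ∧
    p.rel 1 3 0 = starRingEnd ℂ (p.rel 1 2 0) := by
  obtain ⟨a, b, c, hb, hc, h⟩ := h
  refine ⟨2 * b, c, by positivity, hc, ?_, ?_, ?_, ?_⟩ <;> simp only [rel, h] <;>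
    apply Complex.ext <;> simp [toC_re, toC_im] <;> ring

lemma rel_end (h : p.q 1 ∈ QE1set θ) : ∃ b c : ℝ, 0 ≤ b ∧ 0 ≤ c ∧
    p.rel 0 3 1 = Complex.exp (θ * Complex.I) * b ∧
    p.rel 1 2 1 = Complex.exp (θ * Complex.I) * c ∧
    p.rel 2 3 1 = Complex.exp (θ * Complex.I) ^ 2 * starRingEnd ℂ (p.rel 0 1 1) ∧
    p.rel 1 3 1 = Complex.exp (θ * Complex.I) ^ 2 * starRingEnd ℂ (p.rel 0 2 1) := by
  obtain ⟨a, b, c, hb, hc, h⟩ := h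
  have key : ∀ i j, p.rel i j 1 = Complex.exp (θ * Complex.I) *
      (toC (![(-b, -a), (-c, a), (c, a), (b, -a)] j -
        ![(-b, -a), (-c, a), (c, a), (b, -a)] i)) := by
    intro i j
    rw [rel, h, map_sub, toC_rotV, toC_rotV, map_sub, mul_sub]
  have hu := exp_mul_conj_exp θ
  refine ⟨2 * b, 2 * c, by positivity, by positivity, ?_, ?_, ?_, ?_⟩
  · rw [key]
    congr 1
    apply Complex.ext <;> simp <;> ring
  · rw [key]
    congr 1
    apply Complex.ext <;> simp <;> ring
  · rw [key 2 3, key 0 1, map_mul, pow_two, mul_assoc, ← mul_assoc _ (starRingEnd ℂ _), hu, one_mul]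
    congr 1
    apply Complex.ext <;> simp [toC_re, toC_im] <;> ring
  · rw [key 1 3, key 0 2, map_mul, pow_two, mul_assoc, ← mul_assoc _ (starRingEnd ℂ _), hu, one_mul]
    congr 1
    apply Complex.ext <;> simp [toC_re, toC_im] <;> ring

lemma FinitePotential.binary_ge (h : p.FinitePotential) (hS : p.q 0 ∈ QSset)
    (hE : p.q 1 ∈ QE1set θ) (hθ0 : 0 < θ) (hθ : π / 2 + 2 * θ < π) {c : ℝ} (hc : 0 ≤ c)
    (hc' : 4 * c ^ 3 ≤ (π / 2 + 2 * θ) ^ 2 * 2) :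
    3 / 2 * c ≤ p.pairAction 0 1 + p.pairAction 2 3 := by
  obtain ⟨b, d, hb, hd, h1, h2, -, -⟩ := rel_start hS
  obtain ⟨-, -, -, -, -, -, h3, -⟩ := rel_end hE
  have k1 := h.kpath (i := 0) (j := 1) (by decide)
  have k2 := h.kpath (i := 2) (j := 3) (by decide)
  have hn := Complex.norm_exp_ofReal_mul_I θ
  have hu := exp_mul_conj_exp θ
  have l1 := k1.link_mul (u := 1) (by simp)
  have l2 := k2.link_reverse_conj (u := Complex.exp (θ * Complex.I) ^ 2) (by simp [hn])
  rw [h3, show Complex.exp (θ * Complex.I) ^ 2 * starRingEnd ℂ (Complex.exp (θ * Complex.I) ^ 2 *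
      starRingEnd ℂ (p.rel 0 1 1)) = 1 * p.rel 0 1 1 by
    rw [map_mul, map_pow, Complex.conj_conj, ← mul_assoc, ← mul_pow, hu, one_pow]] at l2
  have l3 := l1.trans l2
  have e : Complex.exp (θ * Complex.I) ^ 2 * starRingEnd ℂ (p.rel 2 3 0) =
      b * Complex.exp ((π / 2 + 2 * θ : ℝ) * Complex.I) := by
    rw [h2, ← Complex.exp_nat_mul]
    push_cast
    rw [add_mul, Complex.exp_add, Complex.exp_pi_div_two_mul_I]
    simp
    ring_nf
  rw [e, h1, one_mul] at l3
  have p1 := k1.inv_pos zero_lt_one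
  have p2 := k2.inv_pos zero_lt_one
  have := three_halves_mul_le hc (add_pos p1 p2) (by linarith)
    (l3.sq_mul_le (by positivity) hθ hd hb (add_pos p1 p2))
  simp only [pairAction]
  linarith

lemma FinitePotential.binary_coll (h : p.FinitePotential)
    (hE : p.q 1 ∈ QE1set θ) {φ : ℝ} (hφ0 : 0 < φ) (hφ : φ < π) {c : ℝ} (hc : 0 ≤ c)
    (hc' : 4 * c ^ 3 ≤ φ ^ 2 * 2) {t : ℝ} (ht : t ∈ Icc (0 : ℝ) 1)
    (hcoll : p.rel 0 1 t = 0 ∨ p.rel 2 3 t = 0) :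
    3 / 2 * c ≤ p.pairAction 0 1 + p.pairAction 2 3 := by
  obtain ⟨-, -, -, -, -, -, h3, -⟩ := rel_end hE
  have k1 := h.kpath (i := 0) (j := 1) (by decide)
  have k2 := h.kpath (i := 2) (j := 3) (by decide)
  have hn : ‖p.rel 2 3 1‖ = ‖p.rel 0 1 1‖ := by
    rw [h3]; simp [Complex.norm_exp_ofReal_mul_I θ]
  have p1 := k1.inv_pos zero_lt_one
  have p2 := k2.inv_pos zero_lt_one
  have key : CollLink ‖p.rel 0 1 0‖ ‖p.rel 2 3 0‖ (1 + 1)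
      (p.relEnergy 0 1 + p.relEnergy 2 3) (p.relTime 0 1 + p.relTime 2 3) := by
    rcases hcoll with h0 | h0
    · exact (k1.collLink_one ht h0).trans_norm (hn ▸ k2.normLink_reverse)
    · exact k1.normLink_one.trans_coll (hn ▸ k2.collLink_reverse ht h0)
  have := three_halves_mul_le hc (add_pos p1 p2) (by linarith)
    (key.sq_mul_le hφ0 hφ (norm_nonneg _) (norm_nonneg _) (add_pos p1 p2))
  simp only [pairAction]
  linarith

lemma FinitePotential.cross_ge (h : p.FinitePotential) (hS : p.q 0 ∈ QSset)
    (hE : p.q 1 ∈ QE1set θ) (hθ0 : 0 < θ) (hθ : 4 * θ < π) {c : ℝ} (hc : 0 ≤ c)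
    (hc' : 4 * c ^ 3 ≤ (4 * θ) ^ 2 * 4) :
    3 / 2 * c ≤ p.pairAction 0 3 + p.pairAction 0 2 + p.pairAction 1 3 + p.pairAction 1 2 := by
  obtain ⟨-, -, -, -, -, -, s1, s2⟩ := rel_start hS
  obtain ⟨b, d, hb, hd, e1, e2, -, e3⟩ := rel_end hE
  have k1 := h.kpath (i := 0) (j := 3) (by decide)
  have k2 := h.kpath (i := 0) (j := 2) (by decide)
  have k3 := h.kpath (i := 1) (j := 3) (by decide)
  have k4 := h.kpath (i := 1) (j := 2) (by decide)
  have hn := Complex.norm_exp_ofReal_mul_I θ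
  have hu := exp_mul_conj_exp θ
  have hexp : Complex.exp ((4 * θ : ℝ) * Complex.I) = Complex.exp (θ * Complex.I) ^ 4 := by
    rw [← Complex.exp_nat_mul]; push_cast; ring_nf
  generalize Complex.exp (θ * Complex.I) = u at *
  have l1 := k1.link_reverse_conj hn
  have l2 := k2.link_mul hn
  have l3 := k3.link_reverse_conj (u := u ^ 3) (by simp [hn])
  have l4 := k4.link_mul (u := u ^ 3) (by simp [hn])
  rw [e1, s1, map_mul, ← mul_assoc, hu, one_mul, Complex.conj_conj, Complex.conj_ofReal] at l1
  rw [e3, s2, Complex.conj_conj, map_mul, map_pow, Complex.conj_conj, ← mul_assoc,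
    show u ^ 3 * starRingEnd ℂ u ^ 2 = u * (u * starRingEnd ℂ u) ^ 2 by ring, hu, one_pow,
    mul_one] at l3
  rw [e2, ← mul_assoc, ← pow_succ, ← hexp, mul_comm (Complex.exp _)] at l4
  have p1 := k1.inv_pos zero_lt_one
  have p2 := k2.inv_pos zero_lt_one
  have p3 := k3.inv_pos zero_lt_one
  have p4 := k4.inv_pos zero_lt_one
  have hp := add_pos (add_pos (add_pos p1 p2) p3) p4
  have := three_halves_mul_le hc hp (by linarith)
    ((((l1.trans l2).trans l3).trans l4).sq_mul_le (by positivity) hθ hb hd hp)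
  simp only [pairAction]
  linarith

lemma FinitePotential.cross_coll (h : p.FinitePotential) (hS : p.q 0 ∈ QSset)
    (hE : p.q 1 ∈ QE1set θ) {φ : ℝ} (hφ0 : 0 < φ) (hφ : φ < π) {c : ℝ} (hc : 0 ≤ c)
    (hc' : 4 * c ^ 3 ≤ φ ^ 2 * 4) {t : ℝ} (ht : t ∈ Icc (0 : ℝ) 1)
    (hcoll : p.rel 0 3 t = 0 ∨ p.rel 0 2 t = 0 ∨ p.rel 1 3 t = 0 ∨ p.rel 1 2 t = 0) :
    3 / 2 * c ≤ p.pairAction 0 3 + p.pairAction 0 2 + p.pairAction 1 3 + p.pairAction 1 2 := by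
  obtain ⟨-, -, -, -, -, -, s1, s2⟩ := rel_start hS
  obtain ⟨-, -, -, -, -, -, -, e3⟩ := rel_end hE
  have n1 : ‖p.rel 0 3 0‖ = ‖p.rel 0 2 0‖ := by rw [s1]; simp
  have n2 : ‖p.rel 1 3 1‖ = ‖p.rel 0 2 1‖ := by
    rw [e3]; simp [Complex.norm_exp_ofReal_mul_I θ]
  have n3 : ‖p.rel 1 3 0‖ = ‖p.rel 1 2 0‖ := by rw [s2]; simp
  have k1 := h.kpath (i := 0) (j := 3) (by decide)
  have k2 := h.kpath (i := 0) (j := 2) (by decide)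
  have k3 := h.kpath (i := 1) (j := 3) (by decide)
  have k4 := h.kpath (i := 1) (j := 2) (by decide)
  have l1 := k1.normLink_reverse
  have l2 := k2.normLink_one
  have l3 := k3.normLink_reverse
  have l4 := k4.normLink_one
  rw [n1] at l1
  rw [n2, n3] at l3
  have key : CollLink ‖p.rel 0 3 1‖ ‖p.rel 1 2 1‖ (1 + 1 + 1 + 1)
      (p.relEnergy 0 3 + p.relEnergy 0 2 + p.relEnergy 1 3 + p.relEnergy 1 2)
      (p.relTime 0 3 + p.relTime 0 2 + p.relTime 1 3 + p.relTime 1 2) := by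
    rcases hcoll with h0 | h0 | h0 | h0
    · have c1 := k1.collLink_reverse ht h0
      rw [n1] at c1
      exact ((c1.trans_norm l2).trans_norm l3).trans_norm l4
    · exact ((l1.trans_coll (k2.collLink_one ht h0)).trans_norm l3).trans_norm l4
    · have c3 := k3.collLink_reverse ht h0
      rw [n2, n3] at c3
      exact ((l1.trans l2).trans_coll c3).trans_norm l4
    · exact ((l1.trans l2).trans l3).trans_coll (k4.collLink_one ht h0)
  have p1 := k1.inv_pos zero_lt_one
  have p2 := k2.inv_pos zero_lt_one
  have p3 := k3.inv_pos zero_lt_one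
  have p4 := k4.inv_pos zero_lt_one
  have hp := add_pos (add_pos (add_pos p1 p2) p3) p4
  have := three_halves_mul_le hc hp (by linarith)
    (key.sq_mul_le hφ0 hφ (norm_nonneg _) (norm_nonneg _) hp)
  simp only [pairAction]
  linarith

lemma FinitePotential.pairAction_add_le (h : p.FinitePotential) :
    (p.pairAction 0 1 + p.pairAction 2 3) +
      (p.pairAction 0 3 + p.pairAction 0 2 + p.pairAction 1 3 + p.pairAction 1 2) ≤
      p.realAction := by
  have := h.sum_pairAction_le
  simp only [Finset.sum_filter, Fin.sum_univ_four, Fin.isValue, Fin.reduceLT, lt_self_iff_false,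
    if_true, if_false] at this
  linarith

end H1Path4

/-- The path in `H1Path4` given by continuously differentiable components. -/
def H1Path4.ofDeriv (q v : ℝ → Fin 4 → ℝ × ℝ)
    (hd : ∀ i t, HasDerivAt (fun t => q t i) (v t i) t)
    (hv : ∀ i, Continuous fun t => v t i) : H1Path4 where
  q := q
  v := v
  hvInt i := (hv i).continuousOn.integrableOn_Icc
  hrep i t _ := by
    rw [intervalIntegral.integral_eq_sub_of_hasDerivAt (fun s _ => hd i s)
      ((hv i).intervalIntegrable _ _)]
    abel
  hL2 i := ((continuous_enorm2.comp (hv i)).pow 2).continuousOn.integrableOn_Icc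

lemma action_le_ofReal {p : H1Path4} {C : ℝ}
    (hpos : ∀ t ∈ Icc (0 : ℝ) 1, ∀ i j, i < j → 0 < enorm2 (p.q t i - p.q t j))
    (h : ∀ t ∈ Icc (0 : ℝ) 1, (1 / 2) * ∑ i, enorm2 (p.v t i) ^ 2 +
      ∑ i : Fin 4, ∑ j ∈ Finset.univ.filter (fun j => i < j),
        1 / enorm2 (p.q t i - p.q t j) ≤ C) : action p ≤ ENNReal.ofReal C := by
  have : ∫⁻ _ in Icc (0:ℝ) 1, ENNReal.ofReal C = ENNReal.ofReal C := by simp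
  rw [← this]
  refine setLIntegral_mono' measurableSet_Icc fun t ht => ?_
  refine le_trans (le_of_eq ?_) (ENNReal.ofReal_le_ofReal (h t ht))
  have h0 : ∀ i j, 0 ≤ 1 / enorm2 (p.q t i - p.q t j) :=
    fun i j => div_nonneg zero_le_one (enorm2_nonneg _)
  rw [ENNReal.ofReal_add (by positivity)
    (Finset.sum_nonneg fun i _ => Finset.sum_nonneg fun j _ => h0 i j),
    ENNReal.ofReal_sum_of_nonneg fun i _ => Finset.sum_nonneg fun j _ => h0 i j]
  congr 1
  refine Finset.sum_congr rfl fun i _ => ?_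
  rw [ENNReal.ofReal_sum_of_nonneg fun j _ => h0 i j]
  refine Finset.sum_congr rfl fun j hj => ?_
  rw [one_div, ENNReal.ofReal_inv_of_pos (hpos t ht i j (by simpa using hj))]

lemma le_enorm2 {v : ℝ × ℝ} {c s m : ℝ} (hcs : s ^ 2 + c ^ 2 = 1) (h : m ≤ v.1 * c + v.2 * s) :
    m ≤ enorm2 v := by
  rcases le_or_gt m 0 with hm | hm
  · exact hm.trans (enorm2_nonneg v)
  · refine Real.le_sqrt_of_sq_le ?_
    have h1 : m ^ 2 ≤ (v.1 * c + v.2 * s) ^ 2 := by gcongr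
    nlinarith [sq_nonneg (v.1 * s - v.2 * c)]

/-- A superposition of two uniform rotations. -/
def wave (A B C θ ω t : ℝ) : ℝ × ℝ :=
  (A * cos (θ * t) + B * cos (ω * t) + C * sin (ω * t),
    A * sin (θ * t) + B * sin (ω * t) - C * cos (ω * t))

/-- The velocity of `wave`. -/
def wave' (A B C θ ω t : ℝ) : ℝ × ℝ :=
  (-(A * θ * sin (θ * t)) - B * ω * sin (ω * t) + C * ω * cos (ω * t),
    A * θ * cos (θ * t) + B * ω * cos (ω * t) + C * ω * sin (ω * t))

lemma hasDerivAt_wave (A B C θ ω t : ℝ) :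
    HasDerivAt (wave A B C θ ω) (wave' A B C θ ω t) t := by
  have h1 : HasDerivAt (fun t : ℝ => θ * t) θ t := by simpa using (hasDerivAt_id t).const_mul θ
  have h2 : HasDerivAt (fun t : ℝ => ω * t) ω t := by simpa using (hasDerivAt_id t).const_mul ω
  refine HasDerivAt.prodMk ?_ ?_
  · convert! ((h1.cos.const_mul A).add (h2.cos.const_mul B)).add (h2.sin.const_mul C) using 1
    ring
  · convert! ((h1.sin.const_mul A).add (h2.sin.const_mul B)).sub (h2.cos.const_mul C) using 1
    ring

/-- Two binaries in uniform circular motion around each other, at distance `D`. -/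
def testPath (D θ : ℝ) : H1Path4 :=
  H1Path4.ofDeriv
    (fun t i => wave (![-(D / 2), -(D / 2), D / 2, D / 2] i) (![-0.65, 0.65, 0, 0] i)
      (![0, 0, -0.65, 0.65] i) θ (π / 4 + θ) t)
    (fun t i => wave' (![-(D / 2), -(D / 2), D / 2, D / 2] i) (![-0.65, 0.65, 0, 0] i)
      (![0, 0, -0.65, 0.65] i) θ (π / 4 + θ) t)
    (fun _ _ => hasDerivAt_wave _ _ _ _ _ _)
    (fun i => by unfold wave'; fun_prop)

lemma testPath_inAdm {D θ : ℝ} (hD : 1.3 ≤ D) : inAdm (QE1set θ) (testPath D θ) := by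
  refine ⟨fun t _ => ?_, ⟨D / 2 - 0.65, 0.65, 1.3, by norm_num, by norm_num, ?_⟩,
    ⟨0.65 * (√2 / 2), D / 2 + 0.65 * (√2 / 2), D / 2 - 0.65 * (√2 / 2), by positivity, ?_, ?_⟩⟩
  · simp only [testPath, H1Path4.ofDeriv, wave, Fin.sum_univ_four]
    ext <;> simp <;> ring
  · funext i
    fin_cases i <;> simp [testPath, H1Path4.ofDeriv, wave] <;> norm_num <;> ring
  · have : √2 ≤ 2 := by rw [Real.sqrt_le_left (by norm_num)]; norm_num
    linarith
  · funext i
    fin_cases i <;>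
      simp [testPath, H1Path4.ofDeriv, wave, rotV, cos_add, sin_add] <;>
      constructor <;> ring

lemma testPath_kinetic (D θ t : ℝ) : (1 / 2) * ∑ i, enorm2 ((testPath D θ).v t i) ^ 2 =
    D ^ 2 * θ ^ 2 / 2 + 0.845 * (π / 4 + θ) ^ 2 := by
  have e1 := sin_sq_add_cos_sq (θ * t)
  have e2 := sin_sq_add_cos_sq ((π / 4 + θ) * t)
  simp only [testPath, H1Path4.ofDeriv, wave', Fin.sum_univ_four, enorm2_sq, Fin.isValue,
    Matrix.cons_val_zero, Matrix.cons_val_one, Matrix.cons_val]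
  linear_combination D ^ 2 * θ ^ 2 / 2 * e1 + 0.845 * (π / 4 + θ) ^ 2 * e2

lemma testPath_binary (D θ t : ℝ) : enorm2 ((testPath D θ).q t 0 - (testPath D θ).q t 1) = 1.3 ∧
    enorm2 ((testPath D θ).q t 2 - (testPath D θ).q t 3) = 1.3 := by
  have e2 := sin_sq_add_cos_sq ((π / 4 + θ) * t)
  simp only [testPath, H1Path4.ofDeriv, wave, enorm2, Fin.isValue,
    Matrix.cons_val_zero, Matrix.cons_val_one, Matrix.cons_val, Prod.fst_sub, Prod.snd_sub]
  rw [Real.sqrt_eq_iff_eq_sq (by positivity) (by norm_num),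
    Real.sqrt_eq_iff_eq_sq (by positivity) (by norm_num)]
  constructor <;> linear_combination 1.69 * e2

lemma testPath_cross (D θ t : ℝ) (i j : Fin 4) (h : (i = 0 ∨ i = 1) ∧ (j = 2 ∨ j = 3)) :
    D - 0.92 ≤ enorm2 ((testPath D θ).q t i - (testPath D θ).q t j) := by
  have e1 := sin_sq_add_cos_sq (θ * t)
  have e2 := sin_sq_add_cos_sq ((π / 4 + θ) * t)
  refine le_enorm2 (c := -cos (θ * t)) (s := -sin (θ * t)) (by simp) ?_
  have e3 : (cos ((π / 4 + θ) * t) * cos (θ * t) + sin ((π / 4 + θ) * t) * sin (θ * t)) ^ 2 +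
      (sin ((π / 4 + θ) * t) * cos (θ * t) - cos ((π / 4 + θ) * t) * sin (θ * t)) ^ 2 = 1 := by
    linear_combination (sin ((π / 4 + θ) * t) ^ 2 + cos ((π / 4 + θ) * t) ^ 2) * e1 + e2
  have hb : ∀ a b : ℝ, a ^ 2 + b ^ 2 = 1 → |0.65 * (a + b)| ≤ 0.92 := fun a b hab =>
    abs_le_of_sq_le_sq (by nlinarith [sq_nonneg (a - b)]) (by norm_num)
  have h1 := abs_le.1 (hb _ _ e3)
  have h2 := abs_le.1 (hb _ _ ((congrArg _ (neg_sq _)).trans e3))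
  generalize hS : sin ((π / 4 + θ) * t) = S at *
  generalize hC : cos ((π / 4 + θ) * t) = C at *
  generalize hs : sin (θ * t) = s at *
  generalize hc : cos (θ * t) = c at *
  have hD : D * (s ^ 2 + c ^ 2) = D := by rw [e1, mul_one]
  obtain ⟨rfl | rfl, rfl | rfl⟩ := h <;>
    simp only [testPath, H1Path4.ofDeriv, wave, Fin.isValue, Matrix.cons_val_zero,
      Matrix.cons_val_one, Matrix.cons_val, Prod.fst_sub, Prod.snd_sub, hs, hc, hS, hC] <;>
    linarith

lemma testPath_action_le {D θ : ℝ} (hD : 5.18 ≤ D) (hDθ : D ^ 3 * θ ^ 2 = 4) (h0 : 0 < θ)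
    (h1 : θ ≤ 0.0539 * π) : action (testPath D θ) ≤ ENNReal.ofReal (2.476 + 6 / D) := by
  have hb := testPath_binary D θ
  have hc := testPath_cross D θ
  refine action_le_ofReal (fun t _ i j hij => ?_) fun t _ => ?_
  · have key : (i = 0 ∧ j = 1) ∨ (i = 2 ∧ j = 3) ∨ ((i = 0 ∨ i = 1) ∧ (j = 2 ∨ j = 3)) := by
      revert i j; decide
    rcases key with ⟨rfl, rfl⟩ | ⟨rfl, rfl⟩ | h
    · rw [(hb t).1]; norm_num
    · rw [(hb t).2]; norm_num
    · exact lt_of_lt_of_le (by linarith) (hc t i j h)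
  · rw [testPath_kinetic]
    have hc' : ∀ i j : Fin 4, (i = 0 ∨ i = 1) ∧ (j = 2 ∨ j = 3) →
        1 / enorm2 ((testPath D θ).q t i - (testPath D θ).q t j) ≤ 1 / D + 0.0417 := by
      intro i j h
      refine (one_div_le_one_div_of_le (by linarith) (hc t i j h)).trans ?_
      rw [div_add' _ _ _ (by linarith), div_le_div_iff₀ (by linarith) (by linarith)]
      nlinarith
    have c1 := hc' 0 2 (by simp)
    have c2 := hc' 0 3 (by simp)
    have c3 := hc' 1 2 (by simp)
    have c4 := hc' 1 3 (by simp)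
    have b1 := (hb t).1
    have b2 := (hb t).2
    have hk : D ^ 2 * θ ^ 2 / 2 = 2 / D := by
      field_simp; linarith
    have hω : (π / 4 + θ) ^ 2 ≤ 0.9548 ^ 2 := by
      have := Real.pi_lt_d4
      have := Real.pi_pos
      gcongr
      linarith
    simp only [Finset.sum_filter, Fin.sum_univ_four, Fin.isValue, Fin.reduceLT, lt_self_iff_false,
      if_true, if_false, b1, b2]
    rw [hk, show (6 : ℝ) / D = 6 * (1 / D) by ring, show (2 : ℝ) / D = 2 * (1 / D) by ring]
    norm_num at hω ⊢
    norm_num at c1 c2 c3 c4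
    linarith

/-- The action minimizers in `P(Q_S, Q_{E₁})` are collision-free. -/
lemma isMin.no_collision {θ : ℝ} (hθ0 : 0 < θ) (hθ1 : θ ≤ 0.0539 * π) {p : H1Path4}
    (hp : isMin (QE1set θ) p) :
    p.FinitePotential ∧ ∀ t ∈ Icc (0 : ℝ) 1, ∀ i j, i ≠ j → p.q t i ≠ p.q t j := by
  obtain ⟨D, hD0, hDθ⟩ : ∃ D : ℝ, 0 < D ∧ D ^ 3 * θ ^ 2 = 4 := by
    refine ⟨(4 / θ ^ 2) ^ (1 / 3 : ℝ), by positivity, ?_⟩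
    rw [← Real.rpow_natCast, ← Real.rpow_mul (by positivity)]
    norm_num
    field_simp
  have hπ := Real.pi_lt_d4
  have hπ' := Real.pi_gt_d4
  have hD : 5.18 ≤ D := by
    by_contra! h
    have h1 : D ^ 3 < 5.18 ^ 3 := by gcongr
    have h2 : θ ^ 2 ≤ 0.16934 ^ 2 := by gcongr; linarith
    nlinarith [mul_le_mul h1.le h2 (by positivity) (by positivity)]
  have hact := (hp.2 _ (testPath_inAdm (by linarith))).trans
    (testPath_action_le hD hDθ hθ0 hθ1)
  have hfin : p.FinitePotential := H1Path4.finitePotential_of_action_ne_top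
    (ne_top_of_le_ne_top ENNReal.ofReal_ne_top hact)
  rw [hfin.action_eq, ENNReal.ofReal_le_ofReal_iff (by positivity)] at hact
  obtain ⟨⟨-, hS, hE⟩, -⟩ := hp
  have hsum := hfin.pairAction_add_le
  have hcross := hfin.cross_ge hS hE hθ0 (by linarith) (c := 4 / D) (by positivity) (le_of_eq (by
    field_simp; linear_combination -hDθ))
  have hbin := hfin.binary_ge hS hE hθ0 (by linarith) (c := 1.07) (by norm_num) (by
    nlinarith)
  have h6 : 3 / 2 * (4 / D) = 6 / D := by ring
  have h6' : 6 / D ≤ 1.16 := by rw [div_le_iff₀ hD0]; linarith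
  have hne : ∀ t ∈ Icc (0 : ℝ) 1, ∀ i j, i < j → p.rel i j t ≠ 0 := by
    intro t ht i j hij h0
    have key : (p.rel 0 1 t = 0 ∨ p.rel 2 3 t = 0) ∨
        (p.rel 0 3 t = 0 ∨ p.rel 0 2 t = 0 ∨ p.rel 1 3 t = 0 ∨ p.rel 1 2 t = 0) := by
      fin_cases i <;> fin_cases j <;> simp_all
    rcases key with h | h
    · have := hfin.binary_coll hE (φ := 3.1) (by norm_num) (by linarith) (c := 1.687)
        (by norm_num) (by norm_num) ht h
      linarith
    · have := hfin.cross_coll hS hE (φ := 3.1) (by norm_num) (by linarith) (c := 2.12)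
        (by norm_num) (by norm_num) ht h
      linarith
  refine ⟨hfin, fun t ht i j hij heq => ?_⟩
  rcases lt_or_gt_of_ne hij with h | h
  · exact hne t ht i j h (by simp [H1Path4.rel, heq])
  · exact hne t ht j i h (by simp [H1Path4.rel, heq])

/-- The Euclidean inner product on `ℝ × ℝ`. -/
def dot (a b : ℝ × ℝ) : ℝ := a.1 * b.1 + a.2 * b.2

lemma enorm2_add_le (a b : ℝ × ℝ) : enorm2 (a + b) ≤ enorm2 a + enorm2 b := by
  simpa only [← norm_toC, map_add] using norm_add_le (toC a) (toC b)

lemma enorm2_smul (c : ℝ) (a : ℝ × ℝ) : enorm2 (c • a) = |c| * enorm2 a := by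
  rw [← norm_toC, ← norm_toC, map_smul, norm_smul, Real.norm_eq_abs]

lemma enorm2_neg (a : ℝ × ℝ) : enorm2 (-a) = enorm2 a := by
  rw [← norm_toC, ← norm_toC, map_neg, norm_neg]

/-- Second-order upper bound for the Newtonian potential. -/
lemma one_div_enorm2_add_le {x z : ℝ × ℝ} {d : ℝ} (hd : 0 < d) (hx : d ≤ enorm2 x)
    (hz : enorm2 z ≤ d / 2) :
    1 / enorm2 (x + z) ≤ 1 / enorm2 x - dot x z / enorm2 x ^ 3 + 3 / d ^ 3 * enorm2 z ^ 2 := by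
  have h1 : enorm2 (x + z) ≤ enorm2 x + enorm2 z := enorm2_add_le x z
  have h2 : enorm2 x ≤ enorm2 (x + z) + enorm2 z := by
    simpa [enorm2_neg] using enorm2_add_le (x + z) (-z)
  have h3 : enorm2 (x + z) ^ 2 = enorm2 x ^ 2 + 2 * dot x z + enorm2 z ^ 2 := by
    simp only [enorm2_sq, dot, Prod.fst_add, Prod.snd_add]; ring
  have h4 := enorm2_nonneg z
  set r := enorm2 x
  set s := enorm2 (x + z)
  set m := enorm2 z
  have hr : 0 < r := hd.trans_le hx
  have hs : d / 2 ≤ s := by linarith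
  have hs0 : 0 < s := by linarith
  have hsr : (s - r) ^ 2 ≤ m ^ 2 := sq_le_sq' (by linarith) (by linarith)
  have e : 1 / s - 1 / r + dot x z / r ^ 3 =
      (s - r) ^ 2 * (1 / (2 * r ^ 3) + 1 / (r ^ 2 * s)) - m ^ 2 / (2 * r ^ 3) := by
    have : dot x z = (s ^ 2 - r ^ 2 - m ^ 2) / 2 := by linarith
    rw [this]; field_simp; ring
  have h5 : 1 / (2 * r ^ 3) + 1 / (r ^ 2 * s) ≤ 3 / d ^ 3 := by
    have a1 : 1 / (2 * r ^ 3) ≤ 1 / (2 * d ^ 3) := by gcongr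
    have a2 : 1 / (r ^ 2 * s) ≤ 1 / (d ^ 2 * (d / 2)) := by gcongr
    have a3 : 1 / (2 * d ^ 3) + 1 / (d ^ 2 * (d / 2)) = (5 / 2) / d ^ 3 := by field_simp; ring
    have a4 : (5 / 2 : ℝ) / d ^ 3 ≤ 3 / d ^ 3 := by gcongr; norm_num
    linarith
  have h6 : (s - r) ^ 2 * (1 / (2 * r ^ 3) + 1 / (r ^ 2 * s)) ≤ m ^ 2 * (3 / d ^ 3) := by gcongr
  have h7 : 0 ≤ m ^ 2 / (2 * r ^ 3) := by positivity
  linarith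

/-- The Newtonian force on body `i`. -/
def force (c : Fin 4 → ℝ × ℝ) (i : Fin 4) : ℝ × ℝ :=
  ∑ j ∈ Finset.univ.erase i, (1 / enorm2 (c j - c i) ^ 3) • (c j - c i)

lemma sum_erase_fin_four {M : Type*} [AddCommMonoid M] (f : Fin 4 → Fin 4 → M) :
    ∀ i, ∑ j ∈ Finset.univ.erase i, f i j = ∑ j, if j = i then 0 else f i j := by
  intro i
  rw [← Finset.sum_erase Finset.univ (a := i) (f := fun j => if j = i then 0 else f i j) (by simp)]
  exact Finset.sum_congr rfl fun j hj => by simp [(Finset.mem_erase.1 hj).1]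

lemma sum_dot_force (c h : Fin 4 → ℝ × ℝ) :
    ∑ i, dot (force c i) (h i) = -∑ i : Fin 4, ∑ j ∈ Finset.univ.filter (fun j => i < j),
      dot (c i - c j) (h i - h j) / enorm2 (c i - c j) ^ 3 := by
  simp only [force, sum_erase_fin_four fun i j => (1 / enorm2 (c j - c i) ^ 3) • (c j - c i)]
  simp only [Finset.sum_filter, Fin.sum_univ_four, Fin.isValue, Fin.reduceLT, lt_self_iff_false,
    if_true, if_false, Fin.reduceEq, enorm2_sub_comm (c 1) (c 0), enorm2_sub_comm (c 2) (c 0),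
    enorm2_sub_comm (c 3) (c 0), enorm2_sub_comm (c 2) (c 1), enorm2_sub_comm (c 3) (c 1),
    enorm2_sub_comm (c 3) (c 2), dot, Prod.fst_add, Prod.snd_add, Prod.smul_fst, Prod.smul_snd,
    Prod.fst_sub, Prod.snd_sub, Prod.fst_zero, Prod.snd_zero, smul_eq_mul]
  ring

lemma sum_force (c : Fin 4 → ℝ × ℝ) : ∑ i, force c i = 0 := by
  have h1 := sum_dot_force c fun _ => (1, 0)
  have h2 := sum_dot_force c fun _ => (0, 1)
  simp only [dot, sub_self, Prod.fst_zero, Prod.snd_zero, mul_one, mul_zero, add_zero, zero_add,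
    zero_div, Finset.sum_const_zero, neg_zero] at h1 h2
  ext
  · rwa [Prod.fst_sum]
  · rwa [Prod.snd_sum]

namespace H1Path4

variable {p : H1Path4}

/-- The variation `p + ε h`. -/
def addSMul (p : H1Path4) (ε : ℝ) (h : H1Path4) : H1Path4 where
  q t i := p.q t i + ε • h.q t i
  v t i := p.v t i + ε • h.v t i
  hvInt i := (p.hvInt i).add ((h.hvInt i).smul ε)
  hrep i t ht := by
    have hs : uIcc 0 t ⊆ uIcc (0 : ℝ) 1 := by
      rw [uIcc_of_le ht.1, uIcc_of_le zero_le_one]; exact Icc_subset_Icc_right ht.2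
    rw [intervalIntegral.integral_add (g := fun s => ε • h.v s i)
      ((p.intervalIntegrable_v i).mono_set hs) (((h.intervalIntegrable_v i).mono_set hs).smul ε),
      intervalIntegral.integral_smul, p.hrep i t ht, h.hrep i t ht, smul_add]
    abel
  hL2 i := by
    have := ((p.memLp_v i).add ((h.memLp_v i).const_smul ε)).integrable_norm_pow (by norm_num)
    simpa only [norm_toC, Pi.add_apply, Pi.smul_apply, ← map_smul, ← map_add] using! this

lemma memLp_fst (p : H1Path4) (i : Fin 4) :
    MemLp (fun t => (p.v t i).1) 2 (volume.restrict (Icc 0 1)) :=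
  Complex.reCLM.comp_memLp' (p.memLp_v i)

lemma memLp_snd (p : H1Path4) (i : Fin 4) :
    MemLp (fun t => (p.v t i).2) 2 (volume.restrict (Icc 0 1)) :=
  Complex.imCLM.comp_memLp' (p.memLp_v i)

lemma integrableOn_dot_v (p h : H1Path4) (i : Fin 4) :
    IntegrableOn (fun t => dot (p.v t i) (h.v t i)) (Icc 0 1) :=
  ((p.memLp_fst i).integrable_mul (h.memLp_fst i)).add
    ((p.memLp_snd i).integrable_mul (h.memLp_snd i))

lemma exists_le_enorm2 (hne : ∀ t ∈ Icc (0 : ℝ) 1, ∀ i j, i ≠ j → p.q t i ≠ p.q t j) :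
    ∃ d > 0, ∀ t ∈ Icc (0 : ℝ) 1, ∀ i j, i ≠ j → d ≤ enorm2 (p.q t i - p.q t j) := by
  have h : ∀ x : Fin 4 × Fin 4, ∃ d > 0, x.1 ≠ x.2 → ∀ t ∈ Icc (0 : ℝ) 1,
      d ≤ enorm2 (p.q t x.1 - p.q t x.2) := by
    intro ⟨i, j⟩
    by_cases hij : i = j
    · exact ⟨1, one_pos, fun h => absurd hij h⟩
    obtain ⟨t, ht, hmin⟩ := isCompact_Icc.exists_isMinOn (nonempty_Icc.2 (zero_le_one' ℝ))
      (continuous_enorm2.comp_continuousOn ((p.continuousOn_q i).sub (p.continuousOn_q j)))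
    refine ⟨_, lt_of_le_of_ne (enorm2_nonneg (p.q t i - p.q t j)) fun h0 => ?_,
      fun _ s hs => hmin hs⟩
    exact hne t ht i j hij (sub_eq_zero.1 (enorm2_eq_zero.1 h0.symm))
  choose d hd hle using h
  obtain ⟨x, -, hx⟩ := Finset.exists_min_image (Finset.univ : Finset (Fin 4 × Fin 4)) d
    Finset.univ_nonempty
  exact ⟨d x, hd x, fun t ht i j hij => (hx (i, j) (Finset.mem_univ _)).trans (hle (i, j) hij t ht)⟩

lemma exists_enorm2_le (h : H1Path4) :
    ∃ M > 0, ∀ t ∈ Icc (0 : ℝ) 1, ∀ i j, enorm2 (h.q t i - h.q t j) ≤ M := by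
  have h : ∀ x : Fin 4 × Fin 4, ∃ d, ∀ t ∈ Icc (0 : ℝ) 1,
      enorm2 (h.q t x.1 - h.q t x.2) ≤ d := by
    intro ⟨i, j⟩
    obtain ⟨t, ht, hmax⟩ := isCompact_Icc.exists_isMaxOn (nonempty_Icc.2 (zero_le_one' ℝ))
      (continuous_enorm2.comp_continuousOn ((h.continuousOn_q i).sub (h.continuousOn_q j)))
    exact ⟨_, fun s hs => hmax hs⟩
  choose d hle using h
  obtain ⟨x, -, hx⟩ := Finset.exists_max_image (Finset.univ : Finset (Fin 4 × Fin 4)) d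
    Finset.univ_nonempty
  exact ⟨max (d x) 1, by positivity, fun t ht i j =>
    ((hle (i, j) t ht).trans (hx (i, j) (Finset.mem_univ _))).trans (le_max_left _ _)⟩

end H1Path4

lemma eq_zero_of_quadratic_nonneg {L C r : ℝ} (hr : 0 < r)
    (h : ∀ ε, |ε| < r → 0 ≤ ε * L + ε ^ 2 * C) : L = 0 := by
  by_contra hL
  have hL' : 0 < |L| := abs_pos.2 hL
  set s := min (r / (2 * |L|)) (1 / (2 * (|C| + 1)))
  have hs : 0 < s := lt_min (by positivity) (by positivity)
  have h1 : s * |L| < r := by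
    have : s ≤ r / (2 * |L|) := min_le_left _ _
    rw [le_div_iff₀ (by positivity)] at this
    nlinarith
  have h2 : s * C < 1 := by
    have : s ≤ 1 / (2 * (|C| + 1)) := min_le_right _ _
    rw [le_div_iff₀ (by positivity)] at this
    nlinarith [le_abs_self C, abs_nonneg C]
  have := h (-(s * L)) (by rwa [abs_neg, abs_mul, abs_of_pos hs])
  have h3 : -(s * L) * L + (-(s * L)) ^ 2 * C = (s * L ^ 2) * (s * C - 1) := by ring
  rw [h3] at this
  have : 0 < L ^ 2 := by positivity
  nlinarith [mul_pos (mul_pos hs this) (sub_pos.2 h2)]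

namespace H1Path4

variable {p : H1Path4}

/-- The path `p` has no collision on `[0, 1]`. -/
def NoCollision (p : H1Path4) : Prop :=
  ∀ t ∈ Icc (0 : ℝ) 1, ∀ i j, i ≠ j → p.q t i ≠ p.q t j

lemma NoCollision.continuousOn_inv (hne : p.NoCollision) {i j : Fin 4} (hij : i ≠ j) :
    ContinuousOn (fun t => 1 / enorm2 (p.q t i - p.q t j)) (Icc 0 1) :=
  continuousOn_const.div
    (continuous_enorm2.comp_continuousOn ((p.continuousOn_q i).sub (p.continuousOn_q j)))
    fun t ht h0 => hne t ht i j hij (sub_eq_zero.1 (enorm2_eq_zero.1 h0))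

lemma NoCollision.finitePotential (hne : p.NoCollision) : p.FinitePotential := fun i j hij =>
  ⟨(hne.continuousOn_inv hij.ne).integrableOn_Icc, by
    rw [ae_restrict_iff' measurableSet_Icc]
    exact .of_forall fun t ht => lt_of_le_of_ne (enorm2_nonneg _) fun h0 =>
      hne t ht i j hij.ne (sub_eq_zero.1 (enorm2_eq_zero.1 h0.symm))⟩

lemma continuousOn_dot (p h : H1Path4) (i j k l : Fin 4) :
    ContinuousOn (fun t => dot (p.q t i - p.q t j) (h.q t k - h.q t l)) (Icc 0 1) := by
  have h1 := (p.continuousOn_q i).sub (p.continuousOn_q j)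
  have h2 := (h.continuousOn_q k).sub (h.continuousOn_q l)
  exact (h1.fst.mul h2.fst).add (h1.snd.mul h2.snd)

lemma NoCollision.continuousOn_dot_div (hne : p.NoCollision) (h : H1Path4) {i j : Fin 4}
    (hij : i ≠ j) : ContinuousOn (fun t => dot (p.q t i - p.q t j) (h.q t i - h.q t j) /
      enorm2 (p.q t i - p.q t j) ^ 3) (Icc 0 1) := by
  have := (continuousOn_dot p h i j i j).mul ((hne.continuousOn_inv hij).pow 3)
  refine this.congr fun t _ => ?_
  simp [div_eq_mul_inv]

lemma NoCollision.continuousOn_force (hne : p.NoCollision) (i : Fin 4) :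
    ContinuousOn (fun t => force (p.q t) i) (Icc 0 1) := by
  refine continuousOn_finsetSum _ fun j hj => ?_
  have hij := (Finset.mem_erase.1 hj).1
  have h1 : ContinuousOn (fun t => 1 / enorm2 (p.q t j - p.q t i) ^ 3) (Icc 0 1) :=
    ((hne.continuousOn_inv hij).pow 3).congr fun t _ => by simp
  exact h1.smul ((p.continuousOn_q j).sub (p.continuousOn_q i))

lemma addSMul_kinetic (p h : H1Path4) (ε : ℝ) :
    ∫ t in Icc (0 : ℝ) 1, (1 / 2) * ∑ i, enorm2 ((p.addSMul ε h).v t i) ^ 2 =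
      (∫ t in Icc (0 : ℝ) 1, (1 / 2) * ∑ i, enorm2 (p.v t i) ^ 2) +
      ε * (∫ t in Icc (0 : ℝ) 1, ∑ i, dot (p.v t i) (h.v t i)) +
      ε ^ 2 * ∫ t in Icc (0 : ℝ) 1, (1 / 2) * ∑ i, enorm2 (h.v t i) ^ 2 := by
  have i1 : IntegrableOn (fun t => (1 / 2) * ∑ i, enorm2 (p.v t i) ^ 2) (Icc 0 1) :=
    (integrable_finsetSum _ fun i _ => p.hL2 i).const_mul _
  have i2 : IntegrableOn (fun t => (1 / 2) * ∑ i, enorm2 (h.v t i) ^ 2) (Icc 0 1) :=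
    (integrable_finsetSum _ fun i _ => h.hL2 i).const_mul _
  have i3 : IntegrableOn (fun t => ∑ i, dot (p.v t i) (h.v t i)) (Icc 0 1) :=
    integrable_finsetSum _ fun i _ => p.integrableOn_dot_v h i
  have i4 : IntegrableOn (fun t => (1 / 2) * ∑ i, enorm2 (p.v t i) ^ 2 +
    ε * ∑ i, dot (p.v t i) (h.v t i)) (Icc 0 1) := i1.add (i3.const_mul ε)
  rw [← integral_const_mul ε, ← integral_const_mul (ε ^ 2), ← integral_add i1 (i3.const_mul ε),
    ← integral_add i4 (i2.const_mul (ε ^ 2))]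
  congr 1
  ext t
  simp only [addSMul, enorm2_sq, dot, Prod.fst_add, Prod.snd_add, Prod.smul_fst, Prod.smul_snd,
    smul_eq_mul, Fin.sum_univ_four]
  ring

lemma NoCollision.first_variation (hne : p.NoCollision) (h : H1Path4) {r : ℝ} (hr : 0 < r)
    (hmin : ∀ ε, |ε| < r → action p ≤ action (p.addSMul ε h)) :
    ∫ t in Icc (0 : ℝ) 1,
      (∑ i, dot (p.v t i) (h.v t i) + ∑ i, dot (force (p.q t) i) (h.q t i)) = 0 := by
  obtain ⟨d, hd, hdle⟩ := exists_le_enorm2 hne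
  obtain ⟨M, hM, hMle⟩ := h.exists_enorm2_le
  have i3 : IntegrableOn (fun t => ∑ i, dot (p.v t i) (h.v t i)) (Icc 0 1) :=
    integrable_finsetSum _ fun i _ => p.integrableOn_dot_v h i
  have i4 : ∀ i j : Fin 4, i < j → IntegrableOn
      (fun t => dot (p.q t i - p.q t j) (h.q t i - h.q t j) / enorm2 (p.q t i - p.q t j) ^ 3)
      (Icc 0 1) := fun i j hij => (hne.continuousOn_dot_div h hij.ne).integrableOn_Icc
  set L : Fin 4 → Fin 4 → ℝ := fun i j => ∫ t in Icc (0 : ℝ) 1,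
    dot (p.q t i - p.q t j) (h.q t i - h.q t j) / enorm2 (p.q t i - p.q t j) ^ 3 with hL
  have e : ∫ t in Icc (0 : ℝ) 1,
      (∑ i, dot (p.v t i) (h.v t i) + ∑ i, dot (force (p.q t) i) (h.q t i)) =
      (∫ t in Icc (0 : ℝ) 1, ∑ i, dot (p.v t i) (h.v t i)) -
        ∑ i : Fin 4, ∑ j ∈ Finset.univ.filter (fun j => i < j), L i j := by
    simp only [sum_dot_force, ← sub_eq_add_neg]
    have i5 : ∀ i : Fin 4, IntegrableOn (fun t => ∑ j ∈ Finset.univ.filter (fun j => i < j),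
        dot (p.q t i - p.q t j) (h.q t i - h.q t j) / enorm2 (p.q t i - p.q t j) ^ 3)
        (Icc 0 1) := fun i => integrable_finsetSum _ fun j hj => i4 i j (by simpa using hj)
    rw [integral_sub i3 (integrable_finsetSum _ fun i _ => i5 i),
      integral_finsetSum _ fun i _ => i5 i]
    congr 1
    refine Finset.sum_congr rfl fun i _ => ?_
    exact integral_finsetSum _ fun j hj => i4 i j (by simpa using hj)
  rw [e]
  have hsmall : ∀ ε, |ε| < min r (d / (2 * M)) → ∀ t ∈ Icc (0 : ℝ) 1, ∀ i j,
      enorm2 (ε • (h.q t i - h.q t j)) ≤ d / 2 := fun ε hε t ht i j => by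
    have h1 : |ε| * (2 * M) < d := (lt_div_iff₀ (by positivity)).1 (hε.trans_le (min_le_right _ _))
    have h2 := mul_le_mul_of_nonneg_left (hMle t ht i j) (abs_nonneg ε)
    rw [enorm2_smul]
    linarith
  have hsub : ∀ ε t i j, (p.addSMul ε h).q t i - (p.addSMul ε h).q t j =
      (p.q t i - p.q t j) + ε • (h.q t i - h.q t j) := fun ε t i j => by
    simp only [addSMul, smul_sub]; abel
  have hadd : ∀ ε, |ε| < min r (d / (2 * M)) → (p.addSMul ε h).NoCollision :=
      fun ε hε t ht i j hij h0 => by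
    have h1 := hsub ε t i j
    rw [h0, sub_self] at h1
    have h2 : p.q t i - p.q t j = -(ε • (h.q t i - h.q t j)) := eq_neg_of_add_eq_zero_left h1.symm
    have h3 := hdle t ht i j hij
    rw [h2, enorm2_neg] at h3
    linarith [hsmall ε hε t ht i j]
  obtain ⟨K, hK⟩ : ∃ K, K = 3 / d ^ 3 * M ^ 2 := ⟨_, rfl⟩
  have hpair : ∀ ε, |ε| < min r (d / (2 * M)) → ∀ i j : Fin 4, i < j →
      ∫ t in Icc (0 : ℝ) 1, 1 / enorm2 ((p.addSMul ε h).q t i - (p.addSMul ε h).q t j) ≤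
      (∫ t in Icc (0 : ℝ) 1, 1 / enorm2 (p.q t i - p.q t j)) - ε * L i j + ε ^ 2 * K := by
    intro ε hε i j hij
    have j1 := (hne.continuousOn_inv hij.ne).integrableOn_Icc (μ := volume)
    have j2 := (i4 i j hij).const_mul ε
    have j3 : IntegrableOn (fun _ => ε ^ 2 * K) (Icc (0 : ℝ) 1) :=
      continuousOn_const.integrableOn_Icc
    have j4 : IntegrableOn (fun t => 1 / enorm2 (p.q t i - p.q t j) - ε * (dot (p.q t i - p.q t j)
      (h.q t i - h.q t j) / enorm2 (p.q t i - p.q t j) ^ 3)) (Icc 0 1) := j1.sub j2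
    have e1 : (∫ _ in Icc (0 : ℝ) 1, ε ^ 2 * K) = ε ^ 2 * K := by simp
    rw [hL, ← integral_const_mul, ← integral_sub j1 j2, ← e1, ← integral_add j4 j3]
    refine setIntegral_mono_on ((hadd ε hε).continuousOn_inv hij.ne).integrableOn_Icc
      (j4.add j3) measurableSet_Icc fun t ht => ?_
    rw [hsub]
    refine (one_div_enorm2_add_le hd (hdle t ht i j hij.ne) (hsmall ε hε t ht i j)).trans ?_
    have e2 : dot (p.q t i - p.q t j) (ε • (h.q t i - h.q t j)) =
        ε * dot (p.q t i - p.q t j) (h.q t i - h.q t j) := by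
      simp only [dot, Prod.smul_fst, Prod.smul_snd, smul_eq_mul]; ring
    have h3 : 3 / d ^ 3 * enorm2 (ε • (h.q t i - h.q t j)) ^ 2 ≤ ε ^ 2 * K := by
      rw [enorm2_smul, mul_pow, sq_abs, hK]
      have := pow_le_pow_left₀ (enorm2_nonneg _) (hMle t ht i j) 2
      calc _ = ε ^ 2 * (3 / d ^ 3 * enorm2 (h.q t i - h.q t j) ^ 2) := by ring
        _ ≤ _ := by gcongr
    rw [e2, mul_div_assoc]
    linarith
  set C := (∫ t in Icc (0 : ℝ) 1, (1 / 2) * ∑ i, enorm2 (h.v t i) ^ 2) +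
    ∑ i : Fin 4, ∑ j ∈ Finset.univ.filter (fun j => i < j), K with hC
  refine eq_zero_of_quadratic_nonneg (C := C) (r := min r (d / (2 * M)))
    (lt_min hr (by positivity)) fun ε hε => ?_
  have h1 := hmin ε (hε.trans_le (min_le_left _ _))
  rw [hne.finitePotential.action_eq, (hadd ε hε).finitePotential.action_eq,
    ENNReal.ofReal_le_ofReal_iff realAction_nonneg, realAction, realAction,
    addSMul_kinetic] at h1
  have h2 : ∑ i : Fin 4, ∑ j ∈ Finset.univ.filter (fun j => i < j),
      ∫ t in Icc (0 : ℝ) 1, 1 / enorm2 ((p.addSMul ε h).q t i - (p.addSMul ε h).q t j) ≤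
      ∑ i : Fin 4, ∑ j ∈ Finset.univ.filter (fun j => i < j),
      ((∫ t in Icc (0 : ℝ) 1, 1 / enorm2 (p.q t i - p.q t j)) - ε * L i j + ε ^ 2 * K) :=
    Finset.sum_le_sum fun i _ => Finset.sum_le_sum fun j hj => hpair ε hε i j (by simpa using hj)
  simp only [Finset.sum_add_distrib, Finset.sum_sub_distrib, ← Finset.mul_sum] at h2
  rw [hC, mul_add, mul_sub]
  linarith

end H1Path4

/-- Integration by parts against a function given as a primitive. -/
lemma integral_mul_add_mul_eq_sub {u u' x v : ℝ → ℝ} (hu : ∀ t, HasDerivAt u (u' t) t)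
    (hu' : Continuous u') (hv : IntervalIntegrable v volume 0 1)
    (hx : ∀ t ∈ Icc (0 : ℝ) 1, x t = x 0 + ∫ s in (0 : ℝ)..t, v s) :
    ∫ t in (0 : ℝ)..1, (u' t * x t + u t * v t) = u 1 * x 1 - u 0 * x 0 := by
  have hui : IntervalIntegrable u' volume 0 1 := hu'.intervalIntegrable _ _
  have h1 : AbsolutelyContinuousOnInterval u 0 1 :=
    KPath.absolutelyContinuous_of_rep zero_le_one hui fun t _ => by
      rw [intervalIntegral.integral_eq_sub_of_hasDerivAt (fun s _ => hu s)
        (hu'.intervalIntegrable _ _)]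
      ring
  have h2 := KPath.absolutelyContinuous_of_rep zero_le_one hv hx
  rw [← h1.integral_deriv_mul_eq_sub h2]
  refine intervalIntegral.integral_congr_ae ?_
  have hne : ∀ᵐ t : ℝ, t ≠ 1 := by simp [ae_iff]
  filter_upwards [hv.ae_hasDerivAt_integral, hne] with t ht ht1 htI
  rw [uIoc_of_le zero_le_one] at htI
  have h3 := (ht (by rw [uIcc_of_le zero_le_one]; exact Ioc_subset_Icc_self htI) 0
    left_mem_uIcc).const_add (x 0)
  have h4 : HasDerivAt x (v t) t := h3.congr_of_eventuallyEq <| by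
    filter_upwards [Icc_mem_nhds htI.1 (lt_of_le_of_ne htI.2 ht1)] with s hs using hx s hs
  rw [(hu t).deriv, h4.deriv]

namespace H1Path4

lemma integral_dot_add_dot_eq_sub {y G : ℝ → Fin 4 → ℝ × ℝ}
    (hy : ∀ i t, HasDerivAt (fun s => y s i) (G t i) t) (hG : ∀ i, Continuous fun t => G t i)
    (h : H1Path4) :
    ∫ t in Icc (0 : ℝ) 1, (∑ i, dot (y t i) (h.v t i) + ∑ i, dot (G t i) (h.q t i)) =
      ∑ i, dot (y 1 i) (h.q 1 i) - ∑ i, dot (y 0 i) (h.q 0 i) := by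
  have hsub : ∀ t ∈ Icc (0 : ℝ) 1, uIcc 0 t ⊆ uIcc (0 : ℝ) 1 := fun t ht => by
    rw [uIcc_of_le ht.1, uIcc_of_le zero_le_one]; exact Icc_subset_Icc_right ht.2
  have hv1 : ∀ i, IntervalIntegrable (fun t => (h.v t i).1) volume 0 1 := fun i => by
    rw [intervalIntegrable_iff_integrableOn_Icc_of_le zero_le_one]
    exact (h.hvInt i).fst
  have hv2 : ∀ i, IntervalIntegrable (fun t => (h.v t i).2) volume 0 1 := fun i => by
    rw [intervalIntegrable_iff_integrableOn_Icc_of_le zero_le_one]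
    exact (h.hvInt i).snd
  have hx1 : ∀ i, ∀ t ∈ Icc (0 : ℝ) 1, (h.q t i).1 = (h.q 0 i).1 + ∫ s in (0 : ℝ)..t, (h.v s i).1 :=
    fun i t ht => by
      have := (ContinuousLinearMap.fst ℝ ℝ ℝ).intervalIntegral_comp_comm
        ((h.intervalIntegrable_v i).mono_set (hsub t ht))
      rw [h.hrep i t ht, Prod.fst_add]
      exact congrArg _ this.symm
  have hx2 : ∀ i, ∀ t ∈ Icc (0 : ℝ) 1, (h.q t i).2 = (h.q 0 i).2 + ∫ s in (0 : ℝ)..t, (h.v s i).2 :=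
    fun i t ht => by
      have := (ContinuousLinearMap.snd ℝ ℝ ℝ).intervalIntegral_comp_comm
        ((h.intervalIntegrable_v i).mono_set (hsub t ht))
      rw [h.hrep i t ht, Prod.snd_add]
      exact congrArg _ this.symm
  have hy' : ∀ i, Continuous fun t => y t i := fun i =>
    continuous_iff_continuousAt.2 fun t => (hy i t).continuousAt
  have hq1 : ∀ i, ContinuousOn (fun t => (h.q t i).1) (uIcc 0 1) := fun i => by
    rw [uIcc_of_le zero_le_one]; exact (h.continuousOn_q i).fst
  have hq2 : ∀ i, ContinuousOn (fun t => (h.q t i).2) (uIcc 0 1) := fun i => by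
    rw [uIcc_of_le zero_le_one]; exact (h.continuousOn_q i).snd
  have i1 : ∀ i, IntervalIntegrable (fun t => (G t i).1 * (h.q t i).1 + (y t i).1 * (h.v t i).1)
      volume 0 1 := fun i =>
    ((hG i).fst.continuousOn.mul (hq1 i)).intervalIntegrable.add
      ((hv1 i).continuousOn_mul (hy' i).fst.continuousOn)
  have i2 : ∀ i, IntervalIntegrable (fun t => (G t i).2 * (h.q t i).2 + (y t i).2 * (h.v t i).2)
      volume 0 1 := fun i =>
    ((hG i).snd.continuousOn.mul (hq2 i)).intervalIntegrable.add
      ((hv2 i).continuousOn_mul (hy' i).snd.continuousOn)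
  rw [integral_Icc_eq_integral_Ioc, ← intervalIntegral.integral_of_le zero_le_one]
  have e1 : ∀ i, ∫ t in (0 : ℝ)..1, (((G t i).1 * (h.q t i).1 + (y t i).1 * (h.v t i).1) +
      ((G t i).2 * (h.q t i).2 + (y t i).2 * (h.v t i).2)) =
      dot (y 1 i) (h.q 1 i) - dot (y 0 i) (h.q 0 i) := fun i => by
    rw [intervalIntegral.integral_add (i1 i) (i2 i),
      integral_mul_add_mul_eq_sub (fun t => (hy i t).fst) (hG i).fst (hv1 i) (hx1 i),
      integral_mul_add_mul_eq_sub (fun t => (hy i t).snd) (hG i).snd (hv2 i) (hx2 i), dot, dot]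
    ring
  rw [← Finset.sum_sub_distrib, ← Finset.sum_congr rfl fun i _ => e1 i,
    ← intervalIntegral.integral_finsetSum fun i _ => (i1 i).add (i2 i)]
  congr 1
  ext t
  rw [← Finset.sum_add_distrib]
  refine Finset.sum_congr rfl fun i _ => ?_
  simp only [dot]
  ring

end H1Path4

lemma exists_hasDerivAt_of_boundary {E : Type*} [NormedAddCommGroup E] [NormedSpace ℝ E]
    [CompleteSpace E] {G : ℝ → E} (hG : Continuous G) (A B : E) :
    ∃ y y' : ℝ → E, (∀ t, HasDerivAt y (y' t) t) ∧ (∀ t, HasDerivAt y' (G t) t) ∧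
      y 0 = A ∧ y 1 = B := by
  set P : ℝ → E := fun t => ∫ s in (0 : ℝ)..t, G s with hP
  have hP' : ∀ t, HasDerivAt P (G t) t := fun t => hG.integral_hasStrictDerivAt 0 t |>.hasDerivAt
  have hPc : Continuous P := continuous_iff_continuousAt.2 fun t => (hP' t).continuousAt
  set W : ℝ → E := fun t => ∫ s in (0 : ℝ)..t, P s with hW
  have hW' : ∀ t, HasDerivAt W (P t) t := fun t => hPc.integral_hasStrictDerivAt 0 t |>.hasDerivAt
  refine ⟨fun t => A + t • (B - A - W 1) + W t, fun t => (B - A - W 1) + P t, fun t => ?_,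
    fun t => (hP' t).const_add _, ?_, ?_⟩
  · have := (((hasDerivAt_id t).smul_const (B - A - W 1)).const_add A).add (hW' t)
    simpa using! this
  · simp [hW]
  · simp only [one_smul]; abel

/-- An affine-in-time motion through `0` with zero value at both ends vanishes. -/
lemma eq_zero_of_second_deriv_zero {E : Type*} [NormedAddCommGroup E] [NormedSpace ℝ E]
    {s s' : ℝ → E} (h1 : ∀ t, HasDerivAt s (s' t) t) (h2 : ∀ t, HasDerivAt s' 0 t)
    (h0 : s 0 = 0) (h1' : s 1 = 0) (t : ℝ) : s t = 0 := by
  have hc : ∀ t, s' t = s' 0 := fun t =>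
    is_const_of_deriv_eq_zero (fun t => (h2 t).differentiableAt) (fun t => (h2 t).deriv) t 0
  have h3 : ∀ t, HasDerivAt (fun t => s t - t • s' 0) 0 t := fun t => by
    have := (h1 t).sub ((hasDerivAt_id t).smul_const (s' 0))
    simpa [hc t] using! this
  have h4 : ∀ t, s t - t • s' 0 = s 0 - (0 : ℝ) • s' 0 := fun t =>
    is_const_of_deriv_eq_zero (fun t => (h3 t).differentiableAt) (fun t => (h3 t).deriv) t 0
  have h5 : s' 0 = 0 := by simpa [h0, h1'] using h4 1
  simpa [h0, h5] using h4 t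

/-- `y` is a twice differentiable curve with velocity `y'` and acceleration `y''`. -/
structure IsC2Curve {E : Type*} [NormedAddCommGroup E] [NormedSpace ℝ E] (y y' y'' : ℝ → E) :
    Prop where
  hasDerivAt : ∀ t, HasDerivAt y (y' t) t
  hasDerivAt' : ∀ t, HasDerivAt y' (y'' t) t
  cont : Continuous y''

namespace H1Path4

variable {p : H1Path4}

/-- Variations of `p` along `h` do not decrease the action. -/
def IsStationary (p h : H1Path4) : Prop :=
  ∃ r > 0, ∀ ε, |ε| < r → action p ≤ action (p.addSMul ε h)

lemma NoCollision.exists_isC2Curve (hne : p.NoCollision) (hχ : p.inChi)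
    (hmin : ∀ h : H1Path4, h.inChi → h.q 0 = 0 → h.q 1 = 0 → p.IsStationary h) :
    ∃ y y' y'', IsC2Curve y y' y'' ∧ (∀ t ∈ Icc (0 : ℝ) 1, y t = p.q t) ∧
      (∀ t ∈ Icc (0 : ℝ) 1, y'' t = force (p.q t)) ∧ (∀ t, ∑ i, y t i = 0) ∧
      ∀ h : H1Path4, p.IsStationary h →
        ∑ i, dot (y' 1 i) (h.q 1 i) = ∑ i, dot (y' 0 i) (h.q 0 i) := by
  set G : ℝ → Fin 4 → ℝ × ℝ := fun t => force (p.q (projIcc 0 1 zero_le_one t)) with hGdef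
  have hG : ∀ i, Continuous fun t => G t i := fun i =>
    (continuousOn_iff_continuous_domRestrict.1 (hne.continuousOn_force i)).comp continuous_projIcc
  have hGI : ∀ t ∈ Icc (0 : ℝ) 1, G t = force (p.q t) := fun t ht => by
    simp only [hGdef, projIcc_of_mem zero_le_one ht]
  choose y y' hy hy' hy0 hy1 using fun i =>
    exists_hasDerivAt_of_boundary (hG i) (p.q 0 i) (p.q 1 i)
  have hy'c : ∀ i, Continuous fun t => y' i t := fun i =>
    continuous_iff_continuousAt.2 fun t => (hy' i t).continuousAt
  set Y : H1Path4 := ofDeriv (fun t i => y i t) (fun t i => y' i t) hy hy'c with hY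
  set h : H1Path4 := p.addSMul (-1) Y with hh
  have hsum : ∀ t, ∑ i, y i t = 0 := by
    refine eq_zero_of_second_deriv_zero (s' := fun t => ∑ i, y' i t)
      (fun t => HasDerivAt.fun_sum fun i _ => hy i t) (fun t => ?_) ?_ ?_
    · rw [← sum_force (p.q (projIcc 0 1 zero_le_one t))]
      exact HasDerivAt.fun_sum fun i _ => hy' i t
    · simp only [hy0]; exact hχ 0 (by simp)
    · simp only [hy1]; exact hχ 1 (by simp)
  have key : ∀ k : H1Path4, p.IsStationary k →
      ∫ t in Icc (0 : ℝ) 1, ∑ i, dot (p.v t i - y' i t) (k.v t i) =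
        -(∑ i, dot (y' i 1) (k.q 1 i) - ∑ i, dot (y' i 0) (k.q 0 i)) := by
    rintro k ⟨r, hr, hk⟩
    have h1 := hne.first_variation k hr hk
    have h2 := integral_dot_add_dot_eq_sub (y := fun t i => y' i t) (G := G) hy' hG k
    have j1 : IntegrableOn (fun t => ∑ i, dot (p.v t i) (k.v t i) +
        ∑ i, dot (force (p.q t) i) (k.q t i)) (Icc 0 1) :=
      (integrable_finsetSum _ fun i _ => p.integrableOn_dot_v k i).add
        (integrable_finsetSum _ fun i _ => ContinuousOn.integrableOn_Icc
          (((hne.continuousOn_force i).fst.mul (k.continuousOn_q i).fst).add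
            ((hne.continuousOn_force i).snd.mul (k.continuousOn_q i).snd)))
    have j2 : IntegrableOn (fun t => ∑ i, dot (y' i t) (k.v t i) +
        ∑ i, dot (G t i) (k.q t i)) (Icc 0 1) :=
      (integrable_finsetSum _ fun i _ => Y.integrableOn_dot_v k i).add
        (integrable_finsetSum _ fun i _ => ContinuousOn.integrableOn_Icc
          (((hG i).continuousOn.fst.mul (k.continuousOn_q i).fst).add
            ((hG i).continuousOn.snd.mul (k.continuousOn_q i).snd)))
    have h3 := integral_sub j1 j2
    rw [h1, h2, zero_sub] at h3
    rw [← h3]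
    refine setIntegral_congr_fun measurableSet_Icc fun t ht => ?_
    simp only [hGI t ht, add_sub_add_right_eq_sub, ← Finset.sum_sub_distrib]
    refine Finset.sum_congr rfl fun i _ => ?_
    simp only [dot, Prod.fst_sub, Prod.snd_sub]
    ring
  have hh0 : h.q 0 = 0 := by
    funext i; simp [hh, addSMul, hY, ofDeriv, hy0]
  have hh1 : h.q 1 = 0 := by
    funext i; simp [hh, addSMul, hY, ofDeriv, hy1]
  have hst : p.IsStationary h := by
    refine hmin h (fun t ht => ?_) hh0 hh1
    simp only [hh, addSMul, hY, ofDeriv, Finset.sum_add_distrib, ← Finset.smul_sum, hsum, smul_zero,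
      add_zero]
    exact hχ t ht
  have hz := key h hst
  simp only [hh0, hh1, dot, Pi.zero_apply, Prod.fst_zero, Prod.snd_zero, mul_zero, add_zero,
    Finset.sum_const_zero, sub_self, neg_zero] at hz
  have hv : ∀ᵐ t, t ∈ Icc (0 : ℝ) 1 → ∀ i, p.v t i = y' i t := by
    have hnn : ∀ t, 0 ≤ ∑ i, enorm2 (p.v t i - y' i t) ^ 2 := fun t =>
      Finset.sum_nonneg fun i _ => sq_nonneg _
    have e : ∀ t, ∑ i, ((p.v t i - y' i t).1 * (h.v t i).1 + (p.v t i - y' i t).2 * (h.v t i).2) =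
        ∑ i, enorm2 (p.v t i - y' i t) ^ 2 := fun t => by
      refine Finset.sum_congr rfl fun i _ => ?_
      simp only [enorm2_sq, hh, addSMul, hY, ofDeriv, Prod.fst_sub, Prod.snd_sub, Prod.fst_add,
        Prod.snd_add, Prod.smul_fst, Prod.smul_snd, smul_eq_mul]
      ring
    simp only [e] at hz
    have hi : IntegrableOn (fun t => ∑ i, enorm2 (p.v t i - y' i t) ^ 2) (Icc 0 1) :=
      integrable_finsetSum _ fun i _ => by
        refine (h.hL2 i).congr (.of_forall fun t => ?_)
        simp [hh, addSMul, hY, ofDeriv, sub_eq_add_neg]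
    rw [integral_eq_zero_iff_of_nonneg hnn hi] at hz
    have hz' := (ae_restrict_iff' measurableSet_Icc).1 hz
    filter_upwards [hz'] with t ht htI i
    have := (Finset.sum_eq_zero_iff_of_nonneg fun i _ => sq_nonneg _).1 (ht htI) i
      (Finset.mem_univ i)
    exact sub_eq_zero.1 (enorm2_eq_zero.1 (pow_eq_zero_iff two_ne_zero |>.1 this))
  refine ⟨fun t i => y i t, fun t i => y' i t, G, ⟨fun t => hasDerivAt_pi.2 fun i => hy i t,
    fun t => hasDerivAt_pi.2 fun i => hy' i t, continuous_pi hG⟩, fun t ht => ?_, hGI,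
    hsum, fun k hk => ?_⟩
  · funext i
    have hYt : y i t = y i 0 + ∫ s in (0 : ℝ)..t, y' i s := Y.hrep i t ht
    change y i t = p.q t i
    rw [p.hrep i t ht, hYt]
    congr 1
    · exact hy0 i
    · refine intervalIntegral.integral_congr_ae ?_
      filter_upwards [hv] with s hs hst
      rw [uIoc_of_le ht.1] at hst
      exact (hs ⟨hst.1.le, hst.2.trans ht.2⟩ i).symm
  · have h1 := key k hk
    have h2 : ∫ t in Icc (0 : ℝ) 1, ∑ i, dot (p.v t i - y' i t) (k.v t i) = 0 := by
      refine setIntegral_eq_zero_of_ae_eq_zero ?_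
      filter_upwards [hv] with t ht htI
      simp [ht htI, dot]
    linarith

end H1Path4

section Gluing

variable {E : Type*} [NormedAddCommGroup E] [NormedSpace ℝ E]

lemma hasDerivAt_ite {f g f' g' : ℝ → E} {c : ℝ} (hf : ∀ t, HasDerivAt f (f' t) t)
    (hg : ∀ t, HasDerivAt g (g' t) t) (h : f c = g c) (h' : f' c = g' c) (t : ℝ) :
    HasDerivAt (fun t => if c ≤ t then g t else f t) (if c ≤ t then g' t else f' t) t := by
  rcases lt_trichotomy t c with ht | rfl | ht
  · rw [if_neg ht.not_ge]
    refine (hf t).congr_of_eventuallyEq ?_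
    filter_upwards [Iio_mem_nhds ht] with s hs using if_neg (not_le.2 hs)
  · rw [if_pos le_rfl, ← hasDerivWithinAt_univ, ← Iic_union_Ici (a := t)]
    refine HasDerivWithinAt.union ?_ ?_
    · refine (h' ▸ (hf t).hasDerivWithinAt).congr (fun s hs => ?_) (by simp [h])
      rcases (mem_Iic.1 hs).eq_or_lt with rfl | hs
      · simp [h]
      · exact if_neg hs.not_ge
    · exact (hg t).hasDerivWithinAt.congr (fun s hs => if_pos hs) (by simp)
  · rw [if_pos ht.le]
    refine (hg t).congr_of_eventuallyEq ?_
    filter_upwards [Ioi_mem_nhds ht] with s hs using if_pos (le_of_lt hs)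

/-- The extension of `f` to negative times by `f (-t) = S (f t)`. -/
def reflectExt (S : E → E) (f : ℝ → E) (t : ℝ) : E := if 0 ≤ t then f t else S (f (-t))

lemma reflectExt_of_nonneg {E : Type*} (S : E → E) (f : ℝ → E) {t : ℝ} (ht : 0 ≤ t) :
    reflectExt S f t = f t := if_pos ht

lemma reflectExt_of_neg {E : Type*} (S : E → E) (f : ℝ → E) {t : ℝ} (ht : t < 0) :
    reflectExt S f t = S (f (-t)) := if_neg ht.not_ge

lemma hasDerivAt_reflectExt (S : E ≃L[ℝ] E) {f f' : ℝ → E} (hf : ∀ t, HasDerivAt f (f' t) t)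
    (h : S (f 0) = f 0) (h' : S (f' 0) = -f' 0) (t : ℝ) :
    HasDerivAt (reflectExt S f) (reflectExt (-S.toContinuousLinearMap) f' t) t := by
  refine hasDerivAt_ite (f := fun t => S (f (-t))) (f' := fun t => -S (f' (-t))) (fun t => ?_)
    hf (by simpa using h) (by simp [h']) t
  have h1 : HasDerivAt (fun t => f (-t)) (-f' (-t)) t := by
    simpa using! (hf (-t)).scomp t (hasDerivAt_neg t)
  simpa using! S.toContinuousLinearMap.hasFDerivAt.comp_hasDerivAt t h1

lemma hasDerivAt_reflectExt_neg (S : E ≃L[ℝ] E) {f f' : ℝ → E} (hf : ∀ t, HasDerivAt f (f' t) t)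
    (h : S (f 0) = -f 0) (h' : S (f' 0) = f' 0) (t : ℝ) :
    HasDerivAt (reflectExt (-S.toContinuousLinearMap) f) (reflectExt S f' t) t := by
  refine hasDerivAt_ite (f := fun t => -S (f (-t))) (f' := fun t => S (f' (-t))) (fun t => ?_)
    hf (by simp [h]) (by simpa using h') t
  have h1 : HasDerivAt (fun t => f (-t)) (-f' (-t)) t := by
    simpa using! (hf (-t)).scomp t (hasDerivAt_neg t)
  simpa using! (S.toContinuousLinearMap.hasFDerivAt.comp_hasDerivAt t h1).neg

lemma IsC2Curve.reflectExt {f f' f'' : ℝ → E} (hf : IsC2Curve f f' f'') (S : E ≃L[ℝ] E)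
    (h : S (f 0) = f 0) (h' : S (f' 0) = -f' 0) (h₂ : S (f'' 0) = f'' 0) :
    IsC2Curve (reflectExt S f) (reflectExt (-S.toContinuousLinearMap) f') (reflectExt S f'') where
  hasDerivAt := hasDerivAt_reflectExt S hf.hasDerivAt h h'
  hasDerivAt' := hasDerivAt_reflectExt_neg S hf.hasDerivAt' h' h₂
  cont := by
    refine Continuous.if_le hf.cont (S.continuous.comp (hf.cont.comp continuous_neg))
      continuous_const continuous_id fun t ht => ?_
    simp only [← ht, neg_zero, h₂]

/-- The extension `f (t + 2) = M (f t)` of the restriction of `f` to `[-1, 1]`. -/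
def rotateExt (M : E ≃L[ℝ] E) (f : ℝ → E) (t : ℝ) : E :=
  (M ^ ⌊(t + 1) / 2⌋) (f (t - 2 * ⌊(t + 1) / 2⌋))

variable {M : E ≃L[ℝ] E} {f f' : ℝ → E}

lemma rotateExt_add_two (M : E ≃L[ℝ] E) (f : ℝ → E) (t : ℝ) :
    rotateExt M f (t + 2) = M (rotateExt M f t) := by
  have h : ⌊(t + 2 + 1) / 2⌋ = 1 + ⌊(t + 1) / 2⌋ := by
    rw [show (t + 2 + 1) / 2 = ((1 : ℤ) : ℝ) + (t + 1) / 2 by push_cast; ring,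
      Int.floor_intCast_add]
  rw [rotateExt, h, zpow_add, zpow_one, rotateExt]
  push_cast
  rw [show t + 2 - 2 * (1 + (⌊(t + 1) / 2⌋ : ℝ)) = t - 2 * ⌊(t + 1) / 2⌋ by ring]
  rfl

lemma rotateExt_of_mem_Ico (M : E ≃L[ℝ] E) (f : ℝ → E) {t : ℝ} (ht : t ∈ Ico (-1 : ℝ) 1) :
    rotateExt M f t = f t := by
  have h : ⌊(t + 1) / 2⌋ = 0 :=
    Int.floor_eq_zero_iff.2 ⟨by linarith [ht.1], by linarith [ht.2]⟩
  simp only [rotateExt, h, zpow_zero, Int.cast_zero, mul_zero, sub_zero]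
  rfl

lemma rotateExt_eq_ite (M : E ≃L[ℝ] E) (f : ℝ → E) {t : ℝ} (ht : t ∈ Ioo (-1 : ℝ) 3) :
    rotateExt M f t = if 1 ≤ t then M (f (t - 2)) else f t := by
  split_ifs with h
  · have := rotateExt_add_two M f (t - 2)
    rwa [sub_add_cancel, rotateExt_of_mem_Ico M f (t := t - 2)
      ⟨by linarith, by linarith [ht.2]⟩] at this
  · exact rotateExt_of_mem_Ico M f ⟨ht.1.le, not_le.1 h⟩

lemma rotateExt_of_mem_Icc (h : M (f (-1)) = f 1) {t : ℝ} (ht : t ∈ Icc (-1 : ℝ) 1) :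
    rotateExt M f t = f t := by
  rcases ht.2.eq_or_lt with rfl | h1
  · rw [rotateExt_eq_ite M f (by norm_num), if_pos le_rfl, ← h]
    norm_num
  · exact rotateExt_of_mem_Ico M f ⟨ht.1, h1⟩

lemma forall_of_mem_Ioc {P : ℝ → Prop} (hP : ∀ t, P (t + 2) ↔ P t)
    (h : ∀ t ∈ Ioc (-1 : ℝ) 1, P t) (t : ℝ) : P t := by
  have hper : Function.Periodic P 2 := fun t => propext (hP t)
  obtain ⟨s, hs, e⟩ := hper.exists_mem_Ioc two_pos t (-1)
  rw [e]
  exact h s ⟨hs.1, by linarith [hs.2]⟩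

lemma hasDerivAt_rotateExt (hf : ∀ t, HasDerivAt f (f' t) t) (h : M (f (-1)) = f 1)
    (h' : M (f' (-1)) = f' 1) : ∀ t, HasDerivAt (rotateExt M f) (rotateExt M f' t) t := by
  refine forall_of_mem_Ioc (fun t => ?_) fun t ht => ?_
  · have e : (fun s => M (rotateExt M f s)) = fun s => rotateExt M f (s + 2) := by
      ext1 s; rw [rotateExt_add_two]
    constructor
    · intro h1
      have h2 : HasDerivAt (fun s => M (rotateExt M f s)) (M (rotateExt M f' t)) t := by
        rw [e, ← rotateExt_add_two]; exact h1.comp_add_const t 2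
      have h3 := M.symm.toContinuousLinearMap.hasFDerivAt.comp_hasDerivAt t h2
      simpa [Function.comp_def] using! h3
    · intro h1
      have h2 : HasDerivAt (fun s => M (rotateExt M f s)) (M (rotateExt M f' t)) t :=
        M.toContinuousLinearMap.hasFDerivAt.comp_hasDerivAt t h1
      rw [e, ← rotateExt_add_two] at h2
      have h3 := HasDerivAt.comp_sub_const (t + 2) 2 (f := fun s => rotateExt M f (s + 2))
        (by rwa [add_sub_cancel_right])
      simpa using h3
  · have hm : t ∈ Ioo (-1 : ℝ) 3 := ⟨ht.1, by linarith [ht.2]⟩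
    have h1 := hasDerivAt_ite (c := 1) hf (g := fun t => M (f (t - 2)))
      (g' := fun t => M (f' (t - 2)))
      (fun t => M.toContinuousLinearMap.hasFDerivAt.comp_hasDerivAt t ((hf _).comp_sub_const t 2))
      (by rw [← h]; norm_num) (by rw [← h']; norm_num) t
    rw [← rotateExt_eq_ite M f' hm] at h1
    refine h1.congr_of_eventuallyEq ?_
    filter_upwards [Ioo_mem_nhds hm.1 hm.2] with s hs using rotateExt_eq_ite M f hs

lemma continuous_rotateExt (hf : Continuous f) (h : M (f (-1)) = f 1) :
    Continuous (rotateExt M f) := by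
  refine continuous_iff_continuousAt.2 (forall_of_mem_Ioc (fun t => ?_) fun t ht => ?_)
  · have e : (fun s => M (rotateExt M f s)) = rotateExt M f ∘ (fun s => s + 2) := by
      ext1 s; exact (rotateExt_add_two M f s).symm
    have h1 : ContinuousAt (fun s => M (rotateExt M f s)) t ↔ ContinuousAt (rotateExt M f) t :=
      M.toHomeomorph.comp_continuousAt_iff _ _
    have h2 : ContinuousAt (rotateExt M f ∘ (fun s => s + 2)) t ↔
        ContinuousAt (rotateExt M f) (t + 2) :=
      (Homeomorph.addRight (2 : ℝ)).comp_continuousAt_iff' _ _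
    rw [← h1, e, h2]
  · have hm : t ∈ Ioo (-1 : ℝ) 3 := ⟨ht.1, by linarith [ht.2]⟩
    have h1 : Continuous fun t => if 1 ≤ t then M (f (t - 2)) else f t := by
      refine Continuous.if_le (by fun_prop) hf continuous_const continuous_id fun t ht => ?_
      rw [← ht, ← h]
      norm_num
    refine h1.continuousAt.congr ?_
    filter_upwards [Ioo_mem_nhds hm.1 hm.2] with s hs using (rotateExt_eq_ite M f hs).symm

lemma IsC2Curve.rotateExt {f'' : ℝ → E} (hf : IsC2Curve f f' f'')
    (h : M (f (-1)) = f 1) (h' : M (f' (-1)) = f' 1) (h₂ : M (f'' (-1)) = f'' 1) :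
    IsC2Curve (rotateExt M f) (rotateExt M f') (rotateExt M f'') where
  hasDerivAt := hasDerivAt_rotateExt hf.hasDerivAt h h'
  hasDerivAt' := hasDerivAt_rotateExt hf.hasDerivAt' h' h₂
  cont := continuous_rotateExt hf.cont h₂

lemma IsC2Curve.contDiff {f'' : ℝ → E} (hf : IsC2Curve f f' f'') : ContDiff ℝ 2 f := by
  have e1 : deriv f = f' := funext fun t => (hf.hasDerivAt t).deriv
  have e2 : deriv f' = f'' := funext fun t => (hf.hasDerivAt' t).deriv
  rw [show (2 : WithTop ℕ∞) = 1 + 1 by norm_num, contDiff_succ_iff_deriv]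
  refine ⟨fun t => (hf.hasDerivAt t).differentiableAt, by simp, ?_⟩
  rw [e1, contDiff_one_iff_deriv, e2]
  exact ⟨fun t => (hf.hasDerivAt' t).differentiableAt, hf.cont⟩

end Gluing

/-- The reflection of the plane in the line of angle `φ / 2`. -/
def reflV (φ : ℝ) : (ℝ × ℝ) →ₗ[ℝ] ℝ × ℝ where
  toFun v := (v.1 * cos φ + v.2 * sin φ, v.1 * sin φ - v.2 * cos φ)
  map_add' v w := by ext <;> simp only [Prod.fst_add, Prod.snd_add] <;> ring
  map_smul' c v := by
    ext <;> simp only [Prod.smul_fst, Prod.smul_snd, smul_eq_mul, RingHom.id_apply] <;> ring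

lemma reflV_apply (φ : ℝ) (v : ℝ × ℝ) :
    reflV φ v = (v.1 * cos φ + v.2 * sin φ, v.1 * sin φ - v.2 * cos φ) := rfl

lemma reflV_reflV (φ ψ : ℝ) (v : ℝ × ℝ) : reflV φ (reflV ψ v) = rotV (φ - ψ) v := by
  ext <;> simp only [reflV_apply, rotV, cos_sub, sin_sub] <;> ring

lemma reflV_rotV (φ ψ : ℝ) (v : ℝ × ℝ) : reflV φ (rotV ψ v) = reflV (φ - ψ) v := by
  ext <;> simp only [reflV_apply, rotV, cos_sub, sin_sub] <;> ring

lemma rotV_reflV (φ ψ : ℝ) (v : ℝ × ℝ) : rotV φ (reflV ψ v) = reflV (φ + ψ) v := by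
  ext <;> simp only [reflV_apply, rotV, cos_add, sin_add] <;> ring

lemma rotV_rotV (φ ψ : ℝ) (v : ℝ × ℝ) : rotV φ (rotV ψ v) = rotV (φ + ψ) v := by
  ext <;> simp only [rotV, cos_add, sin_add] <;> ring

lemma rotV_zero (v : ℝ × ℝ) : rotV 0 v = v := by
  ext <;> simp [rotV]

lemma rotV_add_nat_mul_two_pi (φ : ℝ) (n : ℕ) (v : ℝ × ℝ) :
    rotV (φ + n * (2 * π)) v = rotV φ v := by
  simp only [rotV, cos_add_nat_mul_two_pi, sin_add_nat_mul_two_pi]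

lemma enorm2_reflV (φ : ℝ) (v : ℝ × ℝ) : enorm2 (reflV φ v) = enorm2 v := by
  rw [enorm2, enorm2, reflV_apply]
  congr 1
  linear_combination (v.1 ^ 2 + v.2 ^ 2) * cos_sq_add_sin_sq φ

lemma reflV_involutive (φ : ℝ) : Function.Involutive (reflV φ) := fun v => by
  rw [reflV_reflV, sub_self, rotV_zero]

/-- The symmetry of configuration space reflecting the plane and relabelling the bodies. -/
def reflPerm (φ : ℝ) {σ : Fin 4 → Fin 4} (hσ : Function.Involutive σ) :
    (Fin 4 → ℝ × ℝ) ≃L[ℝ] (Fin 4 → ℝ × ℝ) :=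
  (LinearEquiv.ofInvolutive
    { toFun := fun c i => reflV φ (c (σ i))
      map_add' := fun c d => by ext1 i; exact map_add _ _ _
      map_smul' := fun r c => by ext1 i; exact map_smul (reflV φ) r _ }
    fun c => by
      ext1 i
      exact (reflV_involutive φ _).trans (congrArg c (hσ i))).toContinuousLinearEquiv

section reflPerm

variable {φ : ℝ} {σ : Fin 4 → Fin 4} (hσ : Function.Involutive σ)

lemma reflPerm_apply (c : Fin 4 → ℝ × ℝ) (i : Fin 4) :
    reflPerm φ hσ c i = reflV φ (c (σ i)) := rfl

lemma reflPerm_reflPerm (c : Fin 4 → ℝ × ℝ) : reflPerm φ hσ (reflPerm φ hσ c) = c := by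
  ext1 i
  simp only [reflPerm_apply, hσ i, reflV_involutive φ (c i)]

lemma force_reflPerm (c : Fin 4 → ℝ × ℝ) :
    force (reflPerm φ hσ c) = reflPerm φ hσ (force c) := by
  ext1 i
  rw [reflPerm_apply, force, force, map_sum]
  refine Finset.sum_bij (fun j _ => σ j) (fun j hj => ?_) (fun j _ k _ h => hσ.injective h)
    (fun j hj => ⟨σ j, ?_, hσ j⟩) fun j _ => ?_
  · simpa using fun h => (Finset.mem_erase.1 hj).1 (hσ.injective h)
  · refine Finset.mem_erase.2 ⟨fun h => (Finset.mem_erase.1 hj).1 ?_, Finset.mem_univ _⟩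
    rw [← h, hσ j]
  · simp only [reflPerm_apply, map_smul, ← map_sub, enorm2_reflV]

lemma injective_reflPerm {c : Fin 4 → ℝ × ℝ} :
    Function.Injective (reflPerm φ hσ c) ↔ Function.Injective c := by
  have h : ∀ c : Fin 4 → ℝ × ℝ, Function.Injective c →
      Function.Injective (reflPerm φ hσ c) := fun c hc =>
    (reflV_involutive φ).injective.comp (hc.comp hσ.injective)
  refine ⟨fun hc => ?_, h c⟩
  have := h _ hc
  rwa [reflPerm_reflPerm] at this

end reflPerm

lemma involutive_swap_two_three : Function.Involutive (![0, 1, 3, 2] : Fin 4 → Fin 4) := by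
  unfold Function.Involutive; decide

lemma involutive_rev : Function.Involutive (![3, 2, 1, 0] : Fin 4 → Fin 4) := by
  unfold Function.Involutive; decide

/-- The time-reversing symmetry at the starting configuration. -/
def startSymm : (Fin 4 → ℝ × ℝ) ≃L[ℝ] (Fin 4 → ℝ × ℝ) := reflPerm 0 involutive_swap_two_three

/-- The time-reversing symmetry at the final configuration. -/
def endSymm (θ : ℝ) : (Fin 4 → ℝ × ℝ) ≃L[ℝ] (Fin 4 → ℝ × ℝ) :=
  reflPerm (2 * θ + π) involutive_rev

/-- The symmetry relating `Q (t + 2)` to `Q t`. -/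
def stepSymm (θ : ℝ) : (Fin 4 → ℝ × ℝ) ≃L[ℝ] (Fin 4 → ℝ × ℝ) := startSymm.trans (endSymm θ)

lemma stepSymm_apply (θ : ℝ) (c : Fin 4 → ℝ × ℝ) :
    stepSymm θ c = endSymm θ (startSymm c) := rfl

lemma startSymm_startSymm (c : Fin 4 → ℝ × ℝ) : startSymm (startSymm c) = c :=
  reflPerm_reflPerm _ c

lemma stepSymm_apply' (θ : ℝ) (c : Fin 4 → ℝ × ℝ) (i : Fin 4) :
    stepSymm θ c i = rotV (2 * θ + π) (c ((![2, 3, 1, 0] : Fin 4 → Fin 4) i)) := by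
  rw [stepSymm_apply, endSymm, startSymm, reflPerm_apply, reflPerm_apply, reflV_reflV, sub_zero]
  fin_cases i <;> rfl

lemma stepSymm_four (θ : ℝ) (c : Fin 4 → ℝ × ℝ) (i : Fin 4) :
    stepSymm θ (stepSymm θ (stepSymm θ (stepSymm θ c))) i = rotV (8 * θ) (c i) := by
  simp only [stepSymm_apply', rotV_rotV]
  rw [show 2 * θ + π + (2 * θ + π + (2 * θ + π + (2 * θ + π))) = 8 * θ + (2 : ℕ) * (2 * π) by
    push_cast; ring, rotV_add_nat_mul_two_pi]
  fin_cases i <;> rfl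

lemma force_stepSymm (θ : ℝ) (c : Fin 4 → ℝ × ℝ) :
    force (stepSymm θ c) = stepSymm θ (force c) := by
  simp only [stepSymm_apply, endSymm, startSymm, force_reflPerm]

lemma injective_stepSymm {θ : ℝ} {c : Fin 4 → ℝ × ℝ} :
    Function.Injective (stepSymm θ c) ↔ Function.Injective c := by
  simp only [stepSymm_apply, endSymm, startSymm, injective_reflPerm]

/-- A solution arc meeting the two symmetry loci orthogonally extends to a global solution. -/
lemma exists_global_extension {θ : ℝ} {y y' y'' : ℝ → Fin 4 → ℝ × ℝ}
    (hy : IsC2Curve y y' y'') (hf : ∀ t ∈ Icc (0 : ℝ) 1, y'' t = force (y t))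
    (hinj : ∀ t ∈ Icc (0 : ℝ) 1, Function.Injective (y t))
    (h0 : startSymm (y 0) = y 0) (h0' : startSymm (y' 0) = -y' 0)
    (h1 : endSymm θ (y 1) = y 1) (h1' : endSymm θ (y' 1) = -y' 1) :
    ∃ Q Q' Q'', IsC2Curve Q Q' Q'' ∧ (∀ t, Q'' t = force (Q t)) ∧
      (∀ t, Function.Injective (Q t)) ∧ (∀ t ∈ Icc (0 : ℝ) 1, Q t = y t) ∧
      ∀ t, Q (t + 2) = stepSymm θ (Q t) := by
  have h0'' : startSymm (y'' 0) = y'' 0 := by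
    rw [hf 0 (by simp), startSymm, ← force_reflPerm, ← startSymm, h0]
  have h1'' : endSymm θ (y'' 1) = y'' 1 := by
    rw [hf 1 (by simp), endSymm, ← force_reflPerm, ← endSymm, h1]
  have hz := hy.reflectExt startSymm h0 h0' h0''
  have ha : (-1 : ℝ) < 0 := by norm_num
  have e1 : stepSymm θ (reflectExt startSymm y (-1)) = reflectExt startSymm y 1 := by
    rw [reflectExt_of_neg _ _ ha, reflectExt_of_nonneg _ _ zero_le_one, neg_neg, stepSymm_apply,
      startSymm_startSymm, h1]
  have e2 : stepSymm θ (reflectExt (-startSymm.toContinuousLinearMap) y' (-1)) =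
      reflectExt (-startSymm.toContinuousLinearMap) y' 1 := by
    rw [reflectExt_of_neg _ _ ha, reflectExt_of_nonneg _ _ zero_le_one, neg_neg,
      Pi.neg_apply, map_neg, stepSymm_apply, ContinuousLinearEquiv.coe_coe,
      startSymm_startSymm, h1', neg_neg]
  have e3 : stepSymm θ (reflectExt startSymm y'' (-1)) = reflectExt startSymm y'' 1 := by
    rw [reflectExt_of_neg _ _ ha, reflectExt_of_nonneg _ _ zero_le_one, neg_neg, stepSymm_apply,
      startSymm_startSymm, h1'']
  have hneg : ∀ t ∈ Ioc (-1 : ℝ) 1, t < 0 → -t ∈ Icc (0 : ℝ) 1 := fun t ht h =>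
    ⟨by linarith, by linarith [ht.1]⟩
  refine ⟨_, _, _, hz.rotateExt e1 e2 e3, forall_of_mem_Ioc (fun t => ?_) fun t ht => ?_,
    forall_of_mem_Ioc (fun t => ?_) fun t ht => ?_, fun t ht => ?_, rotateExt_add_two _ _⟩
  · rw [rotateExt_add_two, rotateExt_add_two, force_stepSymm, (stepSymm θ).injective.eq_iff]
  · rw [rotateExt_of_mem_Icc e3 (Ioc_subset_Icc_self ht),
      rotateExt_of_mem_Icc e1 (Ioc_subset_Icc_self ht)]
    rcases lt_or_ge t 0 with h | h
    · rw [reflectExt_of_neg _ _ h, reflectExt_of_neg _ _ h, hf _ (hneg t ht h), startSymm,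
        force_reflPerm]
    · rw [reflectExt_of_nonneg _ _ h, reflectExt_of_nonneg _ _ h, hf t ⟨h, ht.2⟩]
  · rw [rotateExt_add_two, injective_stepSymm]
  · rw [rotateExt_of_mem_Icc e1 (Ioc_subset_Icc_self ht)]
    rcases lt_or_ge t 0 with h | h
    · rw [reflectExt_of_neg _ _ h, startSymm, injective_reflPerm]
      exact hinj _ (hneg t ht h)
    · rw [reflectExt_of_nonneg _ _ h]
      exact hinj t ⟨h, ht.2⟩
  · rw [rotateExt_of_mem_Icc e1 ⟨by linarith [ht.1], ht.2⟩, reflectExt_of_nonneg _ _ ht.1]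

/-- The linear-in-time variation with boundary values `A` and `B`. -/
def linearVariation (A B : Fin 4 → ℝ × ℝ) : H1Path4 :=
  H1Path4.ofDeriv (fun t i => A i + t • (B i - A i)) (fun _ i => B i - A i)
    (fun i t => by simpa using! ((hasDerivAt_id t).smul_const (B i - A i)).const_add (A i))
    fun _ => continuous_const

lemma linearVariation_zero (A B : Fin 4 → ℝ × ℝ) : (linearVariation A B).q 0 = A := by
  ext1 i; simp [linearVariation, H1Path4.ofDeriv]

lemma linearVariation_one (A B : Fin 4 → ℝ × ℝ) : (linearVariation A B).q 1 = B := by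
  ext1 i; simp [linearVariation, H1Path4.ofDeriv]

lemma linearVariation_inChi {A B : Fin 4 → ℝ × ℝ} (hA : ∑ i, A i = 0) (hB : ∑ i, B i = 0) :
    (linearVariation A B).inChi := fun t _ => by
  simp [linearVariation, H1Path4.ofDeriv, Finset.sum_add_distrib, ← Finset.smul_sum, hA, hB]

lemma isMin.isStationary {E : Set (Fin 4 → ℝ × ℝ)} {p h : H1Path4} (hp : isMin E p)
    (hh : h.inChi) {r : ℝ} (hr : 0 < r) (h0 : ∀ ε, |ε| < r → p.q 0 + ε • h.q 0 ∈ QSset)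
    (h1 : ∀ ε, |ε| < r → p.q 1 + ε • h.q 1 ∈ E) : p.IsStationary h :=
  ⟨r, hr, fun ε hε => hp.2 _ ⟨fun t ht => by
    simp only [H1Path4.addSMul, Finset.sum_add_distrib, ← Finset.smul_sum, hp.1.1 t ht, hh t ht,
      smul_zero, add_zero], h0 ε hε, h1 ε hε⟩⟩

/-- The parametrization of `QSset`. -/
def startShape (a b c : ℝ) : Fin 4 → ℝ × ℝ :=
  ![(-a - c, 0), (-a, 0), ((2 * a + c) / 2, b), ((2 * a + c) / 2, -b)]

/-- The parametrization of `QE1set` up to rotation. -/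
def endShape (a b c : ℝ) : Fin 4 → ℝ × ℝ := ![(-b, -a), (-c, a), (c, a), (b, -a)]

lemma sum_startShape (a b c : ℝ) : ∑ i, startShape a b c i = 0 := by
  simp only [Fin.sum_univ_four, startShape]
  ext
  · simp; ring
  · simp

lemma sum_rotV_endShape (θ a b c : ℝ) : ∑ i, rotV θ (endShape a b c i) = 0 := by
  simp only [Fin.sum_univ_four, endShape, rotV]
  ext <;> simp <;> ring

lemma startShape_add_smul (a b c α β γ ε : ℝ) :
    startShape a b c + ε • startShape α β γ =
      startShape (a + ε * α) (b + ε * β) (c + ε * γ) := by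
  ext i <;> fin_cases i <;> simp [startShape] <;> ring

lemma endShape_add_smul (θ a b c α β γ ε : ℝ) :
    (fun i => rotV θ (endShape a b c i)) + ε • (fun i => rotV θ (endShape α β γ i)) =
      fun i => rotV θ (endShape (a + ε * α) (b + ε * β) (c + ε * γ) i) := by
  ext i <;> fin_cases i <;> simp [endShape, rotV] <;> ring

lemma add_mul_nonneg_of_abs_lt {b c β ε : ℝ} (hβ : |β| ≤ 1) (hε : |ε| < min b c) :
    0 ≤ b + ε * β ∧ 0 ≤ c + ε * β := by
  have h : |ε * β| ≤ |ε| := by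
    rw [abs_mul]; exact mul_le_of_le_one_right (abs_nonneg ε) hβ
  have h1 := neg_abs_le (ε * β)
  constructor
  · linarith [min_le_left b c]
  · linarith [min_le_right b c]

lemma startSymm_startShape (a b c : ℝ) : startSymm (startShape a b c) = startShape a b c := by
  ext i <;> fin_cases i <;> simp [startSymm, reflPerm_apply, reflV_apply, startShape]

lemma endSymm_rotV (θ : ℝ) (c : Fin 4 → ℝ × ℝ) (i : Fin 4) :
    endSymm θ (fun i => rotV θ (c i)) i =
      rotV θ (reflV π (c ((![3, 2, 1, 0] : Fin 4 → Fin 4) i))) := by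
  rw [endSymm, reflPerm_apply, reflV_rotV, rotV_reflV]
  congr 2; ring

lemma endSymm_endShape (θ a b c : ℝ) :
    endSymm θ (fun i => rotV θ (endShape a b c i)) = fun i => rotV θ (endShape a b c i) := by
  ext1 i
  rw [endSymm_rotV]
  congr 1
  fin_cases i <;> simp [endShape, reflV_apply]

lemma startSymm_eq_neg {w : Fin 4 → ℝ × ℝ} (hs : ∑ i, w i = 0)
    (h : ∀ α β γ : ℝ, |β| ≤ 1 → |γ| ≤ 1 → ∑ i, dot (w i) (startShape α β γ i) = 0) :
    startSymm w = -w := by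
  have ha := h 1 0 0 (by simp) (by simp)
  have hb := h 0 1 0 (by simp) (by simp)
  have hc := h 0 0 1 (by simp) (by simp)
  have hs1 := congrArg Prod.fst hs
  simp only [Fin.sum_univ_four, startShape, dot, Prod.fst_add, Prod.fst_zero, Matrix.cons_val]
    at ha hb hc hs1
  ext i <;> fin_cases i <;> simp [startSymm, reflPerm_apply, reflV_apply] <;> linarith

lemma dot_rotV (θ : ℝ) (v w : ℝ × ℝ) : dot v (rotV θ w) = dot (rotV (-θ) v) w := by
  simp only [dot, rotV, cos_neg, sin_neg]; ring

lemma endSymm_eq_neg {θ : ℝ} {w : Fin 4 → ℝ × ℝ} (hs : ∑ i, w i = 0)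
    (h : ∀ α β γ : ℝ, |β| ≤ 1 → |γ| ≤ 1 →
      ∑ i, dot (w i) (rotV θ (endShape α β γ i)) = 0) :
    endSymm θ w = -w := by
  obtain ⟨u, hu⟩ : ∃ u : Fin 4 → ℝ × ℝ, u = fun i => rotV (-θ) (w i) := ⟨_, rfl⟩
  have hw : w = fun i => rotV θ (u i) := by
    ext1 i; rw [hu, rotV_rotV, add_neg_cancel, rotV_zero]
  have hu' : ∀ i, rotV (-θ) (w i) = u i := fun i => by rw [hu]
  simp only [dot_rotV, hu'] at h
  have hsu : ∑ i, (u i).2 = 0 := by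
    have h1 := congrArg Prod.fst hs
    have h2 := congrArg Prod.snd hs
    simp only [Prod.fst_sum, Prod.snd_sum, Prod.fst_zero, Prod.snd_zero] at h1 h2
    simp only [hu, rotV, Finset.sum_add_distrib, ← Finset.sum_mul, h1, h2, zero_mul, add_zero]
  have ha := h 1 0 0 (by simp) (by simp)
  have hb := h 0 1 0 (by simp) (by simp)
  have hc := h 0 0 1 (by simp) (by simp)
  simp only [Fin.sum_univ_four, endShape, dot, Matrix.cons_val] at ha hb hc hsu
  have key : ∀ i, reflV π (u ((![3, 2, 1, 0] : Fin 4 → Fin 4) i)) = -u i := by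
    intro i
    ext <;> fin_cases i <;> simp [reflV_apply] <;> linarith
  ext1 i
  rw [hw, endSymm_rotV, key]
  ext <;> simp only [rotV, Pi.neg_apply, Prod.fst_neg, Prod.snd_neg] <;> ring

/-- Natural boundary conditions and regularity for a collision-free minimizer. -/
lemma isMin.exists_global {θ : ℝ} {p : H1Path4} (hp : isMin (QE1set θ) p) (hne : p.NoCollision) :
    ∃ Q Q' Q'', IsC2Curve Q Q' Q'' ∧ (∀ t, Q'' t = force (Q t)) ∧
      (∀ t, Function.Injective (Q t)) ∧ (∀ t ∈ Icc (0 : ℝ) 1, Q t = p.q t) ∧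
      ∀ t, Q (t + 2) = stepSymm θ (Q t) := by
  obtain ⟨a, b, c, hb, hc, h0⟩ := hp.1.2.1
  obtain ⟨a', b', c', hb', hc', h1⟩ := hp.1.2.2
  change p.q 0 = startShape a b c at h0
  change p.q 1 = fun i => rotV θ (endShape a' b' c' i) at h1
  have hb : 0 < b := lt_of_le_of_ne hb fun e => hne 0 (by simp) 2 3 (by decide) <| by
    simp [h0, startShape, ← e]
  have hc : 0 < c := lt_of_le_of_ne hc fun e => hne 0 (by simp) 0 1 (by decide) <| by
    simp [h0, startShape, ← e]
  have hb' : 0 < b' := lt_of_le_of_ne hb' fun e => hne 1 (by simp) 0 3 (by decide) <| by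
    simp [h1, endShape, ← e]
  have hc' : 0 < c' := lt_of_le_of_ne hc' fun e => hne 1 (by simp) 1 2 (by decide) <| by
    simp [h1, endShape, ← e]
  obtain ⟨y, y', y'', hy, hyq, hyf, hsum, htr⟩ := hne.exists_isC2Curve hp.1.1 fun h hh e0 e1 =>
    hp.isStationary hh one_pos (fun ε _ => by rw [e0, smul_zero, add_zero]; exact hp.1.2.1)
      fun ε _ => by rw [e1, smul_zero, add_zero]; exact hp.1.2.2
  have hsum' : ∀ t, ∑ i, y' t i = 0 := fun t => by
    have e := HasDerivAt.fun_sum (u := Finset.univ) fun i _ =>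
      hasDerivAt_pi.1 (hy.hasDerivAt t) i
    simp only [hsum] at e
    exact e.unique (hasDerivAt_const t 0)
  have htan : ∀ α β γ α' β' γ' : ℝ, |β| ≤ 1 → |γ| ≤ 1 → |β'| ≤ 1 → |γ'| ≤ 1 →
      ∑ i, dot (y' 1 i) (rotV θ (endShape α' β' γ' i)) =
        ∑ i, dot (y' 0 i) (startShape α β γ i) := by
    intro α β γ α' β' γ' hβ hγ hβ' hγ'
    have := htr (linearVariation (startShape α β γ) fun i => rotV θ (endShape α' β' γ' i)) <|
      hp.isStationary (linearVariation_inChi (sum_startShape _ _ _) (sum_rotV_endShape _ _ _ _))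
        (lt_min (lt_min hb hc) (lt_min hb' hc')) (fun ε hε => ?_) fun ε hε => ?_
    · simpa only [linearVariation_zero, linearVariation_one] using this
    · have hε' := hε.trans_le (min_le_left _ _)
      rw [linearVariation_zero, h0, startShape_add_smul]
      exact ⟨_, _, _, (add_mul_nonneg_of_abs_lt hβ hε').1, (add_mul_nonneg_of_abs_lt hγ hε').2, rfl⟩
    · have hε' := hε.trans_le (min_le_right _ _)
      rw [linearVariation_one, h1, endShape_add_smul]
      exact ⟨_, _, _, (add_mul_nonneg_of_abs_lt hβ' hε').1,
        (add_mul_nonneg_of_abs_lt hγ' hε').2, rfl⟩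
  have hz0 : ∀ w : Fin 4 → ℝ × ℝ, ∑ i, dot (w i) (startShape 0 0 0 i) = 0 := fun w => by
    simp [Fin.sum_univ_four, startShape, dot]
  have hz1 : ∀ w : Fin 4 → ℝ × ℝ, ∑ i, dot (w i) (rotV θ (endShape 0 0 0 i)) = 0 := fun w => by
    simp [Fin.sum_univ_four, endShape, dot, rotV]
  have m0 : (0 : ℝ) ∈ Icc (0 : ℝ) 1 := by simp
  have m1 : (1 : ℝ) ∈ Icc (0 : ℝ) 1 := by simp
  obtain ⟨Q, Q', Q'', hQ, hQf, hinj, hQy, hQ2⟩ := exists_global_extension (θ := θ) hy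
    (fun t ht => by rw [hyf t ht, hyq t ht])
    (fun t ht i j hij => by
      rw [hyq t ht] at hij
      exact not_imp_comm.1 (hne t ht i j) fun h => h hij)
    (by rw [hyq 0 m0, h0, startSymm_startShape])
    (startSymm_eq_neg (hsum' 0) fun α β γ hβ hγ => by
      rw [← htan α β γ 0 0 0 hβ hγ (by simp) (by simp), hz1])
    (by rw [hyq 1 m1, h1, endSymm_endShape])
    (endSymm_eq_neg (hsum' 1) fun α β γ hβ hγ => by
      rw [htan 0 0 0 α β γ (by simp) (by simp) hβ hγ, hz0])
  exact ⟨Q, Q', Q'', hQ, hQf, hinj, fun t ht => (hQy t ht).trans (hyq t ht), hQ2⟩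

/-- For `0 < θ ≤ 0.0539·π`, an action minimizer over `P(Q_S, Q_{E₁})`
extends to a global, collision-free, `C²` solution of the Newtonian equations with
rotation symmetry `Qᵢ(t+8) = Qᵢ(t)·R(8θ)`; if `θ = (k/l)·π` the extension is
periodic with period `8l`. -/
theorem statement1 (θ : ℝ) (hθ0 : 0 < θ) (hθ1 : θ ≤ 0.0539 * π)
    (p : H1Path4) (hp : isMin (QE1set θ) p) :
    ∃ Q : ℝ → Fin 4 → ℝ × ℝ,
      ContDiff ℝ 2 Q ∧
      (∀ t : ℝ, ∀ i j : Fin 4, i ≠ j → Q t i ≠ Q t j) ∧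
      newton Q Set.univ ∧
      (∀ t ∈ Icc (0:ℝ) 1, Q t = p.q t) ∧
      (∀ t : ℝ, ∀ i : Fin 4, Q (t + 8) i = rotV (8 * θ) (Q t i)) ∧
      (∀ k l : ℕ, 0 < k → 0 < l → θ = (k : ℝ) / l * π →
        ∀ t : ℝ, Q (t + 8 * l) = Q t) := by
  obtain ⟨-, hne⟩ := hp.no_collision hθ0 hθ1
  obtain ⟨Q, Q', Q'', hQ, hQf, hinj, hQp, hQ2⟩ := hp.exists_global hne
  have h8 : ∀ t i, Q (t + 8) i = rotV (8 * θ) (Q t i) := fun t i => by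
    rw [← stepSymm_four, ← hQ2, ← hQ2, ← hQ2, ← hQ2]
    ring_nf
  refine ⟨Q, hQ.contDiff, fun t i j hij h => hij (hinj t h), fun i t _ => ?_, hQp, h8,
    fun k l _ hl hkl t => ?_⟩
  · have e : deriv (fun u => Q u i) = fun u => Q' u i :=
      funext fun s => (hasDerivAt_pi.1 (hQ.hasDerivAt s) i).deriv
    rw [e, (hasDerivAt_pi.1 (hQ.hasDerivAt' t) i).deriv, hQf]
    rfl
  · have hn : ∀ n : ℕ, ∀ i, Q (t + 8 * n) i = rotV (8 * θ * n) (Q t i) := fun n => by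
      induction n with
      | zero => simp [rotV_zero]
      | succ n ih =>
        intro i
        rw [Nat.cast_succ, mul_add, mul_one, ← add_assoc, h8, ih, rotV_rotV]
        congr 1; ring
    ext1 i
    have e : 8 * θ * l = 0 + (4 * k : ℕ) * (2 * π) := by
      rw [hkl]; push_cast; field_simp; ring
    rw [hn, e, rotV_add_nat_mul_two_pi, rotV_zero]

end
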